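/- arXiv:0808.3344 — 2 statements merged into one kernel-verified Lean document; each statement's English description precedes it below -/
import Mathlib

section
/- Let d ≥ 3. For every ρ > 0 there exists u(ρ) > 0 such that for all 0 < u ≤ u(ρ) and every vacant-set law Q at level u, lim_{L → ∞} L^ρ · Q[ there is a *-path from 0 to S(0, L) all of whose points lie in {x ∈ ℤ² : Y_x = 0} ] = 0, where S(0, L) = {x ∈ ℤ^d : |x|_∞ = L} is the ℓ^∞-sphere of radius L. -/
open MeasureTheory Filter

namespace RI

/-- Points of `ℤ^d`. -/
abbrev Zd (d : ℕ) := Fin d → ℤ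

/-- `x` and `y` are nearest neighbours: `|x - y| = 1`. -/
def adj {d : ℕ} (x y : Zd d) : Prop := (∑ i, |x i - y i|) = 1

/-- `x` and `y` are `*`-neighbours: `|x - y|_∞ = 1`. -/
def starAdj {d : ℕ} (x y : Zd d) : Prop := x ≠ y ∧ ∀ i, |x i - y i| ≤ 1

/-- `x` belongs to the plane `ℤ e₁ + ℤ e₂ ⊆ ℤ^d`. -/
def inPlane {d : ℕ} (x : Zd d) : Prop := ∀ i : Fin d, 2 ≤ (i : ℕ) → x i = 0

/-- The `k`-th coordinate of `x`, with value `0` for out-of-range indices. -/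
def coord {d : ℕ} (x : Zd d) (k : ℕ) : ℤ := if h : k < d then x ⟨k, h⟩ else 0

/-- `P` is the family of laws of the simple random walks on `ℤ^d` started at the points of
`ℤ^d`: each `P x` is a probability measure on the path space `ℕ → ℤ^d`, and the cylinder
probabilities are those of the walk with i.i.d. increments uniform on `{± e_i}`. -/
def IsSRW (d : ℕ) (P : Zd d → Measure (ℕ → Zd d)) : Prop :=
  (∀ x, IsProbabilityMeasure (P x)) ∧
  (∀ (x : Zd d) (n : ℕ) (w : ℕ → Zd d),
      (w 0 = x ∧ ∀ k < n, adj (w k) (w (k + 1))) →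
        P x {ω | ∀ k ≤ n, ω k = w k} = ((2 * d : ENNReal))⁻¹ ^ n) ∧
  (∀ (x : Zd d) (n : ℕ) (w : ℕ → Zd d),
      ¬(w 0 = x ∧ ∀ k < n, adj (w k) (w (k + 1))) →
        P x {ω | ∀ k ≤ n, ω k = w k} = 0)

/-- The equilibrium measure of a set `V ⊆ ℤ^d`:
`e_V(x) = P_x[H̃_V = ∞]` for `x ∈ V`, and `0` otherwise. -/
noncomputable def eqm {d : ℕ} (P : Zd d → Measure (ℕ → Zd d)) (V : Set (Zd d)) : Zd d → ℝ :=
  V.indicator fun x => (P x {ω | ∀ n, 1 ≤ n → ω n ∉ V}).toReal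

/-- The capacity of a finite set `K ⊆ ℤ^d`. -/
noncomputable def capa {d : ℕ} (P : Zd d → Measure (ℕ → Zd d)) (K : Finset (Zd d)) : ℝ :=
  ∑ x ∈ K, eqm P (↑K) x

/-- `Q` is a vacant-set law at level `u`: a probability measure on `{0,1}^{ℤ^d}`
(with `true = 1` standing for "vacant") such that
`Q[Y_x = 1 ∀ x ∈ K] = exp(-u cap K)` for every finite `K`. -/
def IsVacantLaw {d : ℕ} (P : Zd d → Measure (ℕ → Zd d)) (u : ℝ)
    (Q : Measure (Zd d → Bool)) : Prop :=
  IsProbabilityMeasure Q ∧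
  ∀ K : Finset (Zd d),
    Q {Y | ∀ x ∈ K, Y x = true} = ENNReal.ofReal (Real.exp (-(u * capa P K)))

/-- There is a `*`-path starting in `S`, ending in `T`, all of whose points lie in `A`. -/
def HasStarPath {d : ℕ} (S T A : Set (Zd d)) : Prop :=
  ∃ (N : ℕ) (w : ℕ → Zd d), w 0 ∈ S ∧ w N ∈ T ∧ (∀ k ≤ N, w k ∈ A) ∧
    ∀ k < N, starAdj (w k) (w (k + 1))

/-- Interior boundary `∂_int U`. -/
def intBdry {d : ℕ} (U : Set (Zd d)) : Set (Zd d) := {x | x ∈ U ∧ ∃ y, y ∉ U ∧ adj x y}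

/-- (Exterior) boundary `∂U`. -/
def bdry {d : ℕ} (U : Set (Zd d)) : Set (Zd d) := {x | x ∉ U ∧ ∃ y ∈ U, adj x y}

/-- `ℓ = 100 ⌊L^{1/100}⌋ + 1`. -/
noncomputable def ellOf (L : ℕ) : ℕ := 100 * ⌊(L : ℝ) ^ ((1 : ℝ) / 100)⌋₊ + 1

/-- The scales `L_{n+1} = ℓ_n L_n`. -/
noncomputable def Lseq (L0 : ℕ) : ℕ → ℕ
  | 0 => L0
  | n + 1 => ellOf (Lseq L0 n) * Lseq L0 n

/-- The levels `u_{n+1} = (1 + 1/log L_n)⁻¹ u_n`. -/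
noncomputable def useq (L0 : ℕ) (u0 : ℝ) : ℕ → ℝ
  | 0 => u0
  | n + 1 => (1 + 1 / Real.log (Lseq L0 n))⁻¹ * useq L0 u0 n

/-- The event (on the configuration space `{0,1}^{ℤ^d}`) that there is a `*`-path from
`[-L,L]² ∩ ℤ²` to `∂_int ([-3L,3L]^d ∩ ℤ^d)` all of whose points lie in `{x ∈ ℤ² : Y_x = 0}`. -/
def qEvent (d : ℕ) (L : ℕ) : Set (Zd d → Bool) :=
  {Y | HasStarPath
    {x : Zd d | inPlane x ∧ ∀ i, |x i| ≤ (L : ℤ)}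
    (intBdry {x : Zd d | ∀ i, |x i| ≤ (3 * L : ℤ)})
    {x : Zd d | inPlane x ∧ Y x = false}}


end RI

open RI MeasureTheory Filter

namespace RI

/-- The `2d` steps of the walk: a coordinate direction and a sign. -/
abbrev Dir (d : ℕ) := Fin d × Bool

/-- The increment attached to a direction. -/
def step {d : ℕ} (v : Dir d) : Zd d := Pi.single v.1 (if v.2 then 1 else -1)

/-- The average of `f` over the `2d` nearest neighbours of `x`. -/
noncomputable def avg {d : ℕ} (f : Zd d → ℝ) (x : Zd d) : ℝ :=
  (∑ v : Dir d, f (x + step v)) / (2 * d)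

lemma avg_mono {d : ℕ} {f g : Zd d → ℝ} (h : ∀ x, f x ≤ g x) (x : Zd d) : avg f x ≤ avg g x := by
  unfold avg
  gcongr with v
  exact h _

lemma avg_const {d : ℕ} (hd : d ≠ 0) (c : ℝ) (x : Zd d) : avg (fun _ => c) x = c := by
  have : (d : ℝ) ≠ 0 := by exact_mod_cast hd
  simp [avg]
  field_simp

/-! ### A positive superharmonic function -/

/-- The superharmonic function `x ↦ (|x|² + 10)^{-1/2}`. -/
noncomputable def pot {d : ℕ} (x : Zd d) : ℝ := 1 / √((∑ i, (x i : ℝ) ^ 2) + 10)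

lemma pot_nonneg {d : ℕ} (x : Zd d) : 0 ≤ pot x := by unfold pot; positivity

lemma pot_le {d : ℕ} (x : Zd d) (i : Fin d) {D : ℝ} (hD : 0 < D) (h : D ≤ |(x i : ℝ)|) :
    pot x ≤ 1 / D := by
  unfold pot
  apply one_div_le_one_div_of_le hD
  apply Real.le_sqrt_of_sq_le
  have h1 : (x i : ℝ) ^ 2 ≤ ∑ i, (x i : ℝ) ^ 2 :=
    Finset.single_le_sum (f := fun i => (x i : ℝ) ^ 2) (fun _ _ => sq_nonneg _) (Finset.mem_univ i)
  have h2 : D ^ 2 ≤ (x i : ℝ) ^ 2 := by rw [← sq_abs (x i : ℝ)]; gcongr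
  linarith

lemma inv_sqrt_add_inv_sqrt_le {v : ℝ} (hv : v ^ 2 ≤ 1 / 4) :
    1 / √(1 + v) + 1 / √(1 - v) ≤ 2 + 3 / 4 * v ^ 2 + 2 * v ^ 4 := by
  have h1 : 0 < 1 + v := by nlinarith
  have h2 : 0 < 1 - v := by nlinarith
  set w := v ^ 2 with hw
  have hw0 : 0 ≤ w := sq_nonneg v
  have hv4 : v ^ 4 = w ^ 2 := by rw [hw]; ring
  have h3 : 0 < 1 - w := by linarith
  rw [hv4]
  refine (abs_le_of_sq_le_sq' ?_ (by positivity)).2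
  have e1 : (1 / √(1 + v)) ^ 2 = 1 / (1 + v) := by rw [div_pow, Real.sq_sqrt h1.le]; simp
  have e2 : (1 / √(1 - v)) ^ 2 = 1 / (1 - v) := by rw [div_pow, Real.sq_sqrt h2.le]; simp
  have e3 : (1 / √(1 + v)) * (1 / √(1 - v)) = 1 / √(1 - w) := by
    rw [one_div_mul_one_div, ← Real.sqrt_mul h1.le, hw]
    congr 2; ring
  have e4 : 1 / (1 + v) + 1 / (1 - v) = 2 / (1 - w) := by
    rw [hw, show 1 - v ^ 2 = (1 + v) * (1 - v) by ring]
    field_simp; ring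
  have b1 : 1 / (1 - w) ≤ 1 + w + 4 / 3 * w ^ 2 := by
    rw [div_le_iff₀ h3]
    nlinarith [mul_nonneg (sq_nonneg w) (show 0 ≤ 1 / 4 - w by linarith)]
  have b2 : 1 / √(1 - w) ≤ 1 + w / 2 + w ^ 2 := by
    refine (abs_le_of_sq_le_sq' ?_ (by positivity)).2
    rw [div_pow, Real.sq_sqrt h3.le, one_pow]
    refine b1.trans ?_
    nlinarith [mul_nonneg hw0 (sq_nonneg w), sq_nonneg w, sq_nonneg (w ^ 2)]
  have b3 : 2 / (1 - w) = 2 * (1 / (1 - w)) := by ring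
  calc (1 / √(1 + v) + 1 / √(1 - v)) ^ 2
      = (1 / √(1 + v)) ^ 2 + (1 / √(1 - v)) ^ 2 + 2 * ((1 / √(1 + v)) * (1 / √(1 - v))) := by ring
    _ = 2 * (1 / (1 - w)) + 2 * (1 / √(1 - w)) := by rw [e1, e2, e3, e4, b3]
    _ ≤ 2 * (1 + w + 4 / 3 * w ^ 2) + 2 * (1 + w / 2 + w ^ 2) := by linarith
    _ ≤ _ := by
        nlinarith [mul_nonneg hw0 (sq_nonneg w), sq_nonneg w, sq_nonneg (w ^ 2)]

lemma sum_sq_add_step {d : ℕ} (x : Zd d) (v : Dir d) :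
    ∑ i, (((x + step v) i : ℤ) : ℝ) ^ 2
      = (∑ i, (x i : ℝ) ^ 2) + 1 + (if v.2 then 2 * (x v.1 : ℝ) else -(2 * (x v.1 : ℝ))) := by
  have : ∀ i, (((x + step v) i : ℤ) : ℝ) ^ 2 = (x i : ℝ) ^ 2 +
      (if i = v.1 then 1 + (if v.2 then 2 * (x v.1 : ℝ) else -(2 * (x v.1 : ℝ))) else 0) := by
    intro i
    by_cases h : i = v.1
    · subst h
      cases hv : v.2 <;> simp [step, hv] <;> ring
    · simp [step, h]
  rw [Finset.sum_congr rfl fun i _ => this i, Finset.sum_add_distrib]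
  simp
  ring

lemma avg_pot_le {d : ℕ} (hd : 3 ≤ d) (x : Zd d) : avg pot x ≤ pot x := by
  set s : ℝ := ∑ i, (x i : ℝ) ^ 2 with hs
  have hs0 : 0 ≤ s := Finset.sum_nonneg fun _ _ => sq_nonneg _
  set t : ℝ := s + 11 with ht
  have ht0 : 0 < t := by linarith
  have hd' : (3 : ℝ) ≤ d := by exact_mod_cast hd
  have key : ∀ i : Fin d, 1 / √(t + 2 * (x i : ℝ)) + 1 / √(t - 2 * (x i : ℝ))
      ≤ 1 / √t * (2 + 3 * (x i : ℝ) ^ 2 / t ^ 2 + 32 * (x i : ℝ) ^ 4 / t ^ 4) := by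
    intro i
    have hx : (x i : ℝ) ^ 2 ≤ s :=
      Finset.single_le_sum (f := fun i => (x i : ℝ) ^ 2) (fun _ _ => sq_nonneg _)
        (Finset.mem_univ i)
    have hv : (2 * (x i : ℝ) / t) ^ 2 ≤ 1 / 4 := by
      rw [div_pow, div_le_div_iff₀ (by positivity) (by norm_num)]
      nlinarith
    have h := inv_sqrt_add_inv_sqrt_le hv
    have a1 : √(t + 2 * (x i : ℝ)) = √t * √(1 + 2 * (x i : ℝ) / t) := by
      rw [← Real.sqrt_mul ht0.le]; congr 1; field_simp
    have a2 : √(t - 2 * (x i : ℝ)) = √t * √(1 - 2 * (x i : ℝ) / t) := by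
      rw [← Real.sqrt_mul ht0.le]; congr 1; field_simp
    rw [a1, a2, ← one_div_mul_one_div, ← one_div_mul_one_div, ← mul_add]
    refine mul_le_mul_of_nonneg_left (h.trans (le_of_eq ?_)) (by positivity)
    field_simp
    ring
  have hsum : ∑ v : Dir d, pot (x + step v)
      = ∑ i, (1 / √(t + 2 * (x i : ℝ)) + 1 / √(t - 2 * (x i : ℝ))) := by
    rw [Fintype.sum_prod_type]
    refine Finset.sum_congr rfl fun i _ => ?_
    rw [Fintype.sum_bool]
    unfold pot
    rw [sum_sq_add_step, sum_sq_add_step]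
    simp only [if_true, Bool.false_eq_true, if_false]
    rw [← hs]
    congr 3 <;> rw [ht] <;> ring
  have h4 : ∑ i, (x i : ℝ) ^ 4 ≤ s ^ 2 := by
    have : ∀ i ∈ Finset.univ, (x i : ℝ) ^ 4 ≤ (x i : ℝ) ^ 2 * s := by
      intro i _
      have hx : (x i : ℝ) ^ 2 ≤ s :=
        Finset.single_le_sum (f := fun i => (x i : ℝ) ^ 2) (fun _ _ => sq_nonneg _)
          (Finset.mem_univ i)
      nlinarith [sq_nonneg (x i : ℝ)]
    refine (Finset.sum_le_sum this).trans (le_of_eq ?_)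
    rw [← Finset.sum_mul, ← hs, sq]
  have hr : 1 / √t * (1 + 1 / (2 * t)) ≤ 1 / √(t - 1) := by
    have h1 : 0 < t - 1 := by linarith
    refine (abs_le_of_sq_le_sq' ?_ (by positivity)).2
    rw [mul_pow, div_pow, div_pow, Real.sq_sqrt ht0.le, Real.sq_sqrt h1.le, one_pow]
    rw [← sub_nonneg]
    have : 1 / (t - 1) - 1 / t * (1 + 1 / (2 * t)) ^ 2 = (3 * t + 1) / (4 * t ^ 3 * (t - 1)) := by
      field_simp; ring
    rw [this]; positivity
  have hpot : pot x = 1 / √(t - 1) := by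
    unfold pot; rw [← hs, ht]; congr 2; ring
  rw [hpot]
  refine le_trans ?_ hr
  unfold avg
  rw [div_le_iff₀ (by positivity), hsum]
  refine (Finset.sum_le_sum fun i _ => key i).trans ?_
  rw [← Finset.mul_sum, Finset.sum_add_distrib, Finset.sum_add_distrib, mul_assoc]
  refine mul_le_mul_of_nonneg_left ?_ (by positivity)
  rw [← Finset.sum_div, ← Finset.sum_div, ← Finset.mul_sum, ← Finset.mul_sum, ← hs]
  simp only [Finset.sum_const, Finset.card_univ, Fintype.card_fin, nsmul_eq_mul]
  have h5 : 3 * s / t ^ 2 + 32 * (∑ i, (x i : ℝ) ^ 4) / t ^ 4 ≤ 3 / t := by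
    rw [← sub_nonneg]
    have : 3 / t - (3 * s / t ^ 2 + 32 * (∑ i, (x i : ℝ) ^ 4) / t ^ 4)
      = (3 * (t - s) * t ^ 2 - 32 * (∑ i, (x i : ℝ) ^ 4)) / t ^ 4 := by
      field_simp; ring
    rw [this]
    apply div_nonneg _ (by positivity)
    nlinarith
  have h6 : 3 / t ≤ d / t := by gcongr
  have h7 : (1 + 1 / (2 * t)) * (2 * d) = d * 2 + d / t := by field_simp
  rw [h7]
  linarith

/-! ### Hitting probabilities of the (possibly killed) walk -/

open Classical in
/-- Probability that the walk started at `x` and killed outside `Λ` visits `K` within `n` steps. -/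
noncomputable def hitN {d : ℕ} (K Λ : Set (Zd d)) : ℕ → Zd d → ℝ
  | 0, x => if x ∈ K then 1 else 0
  | n + 1, x => if x ∈ K then 1 else if x ∈ Λ then avg (hitN K Λ n) x else 0

/-- Probability that the walk started at `x` and killed outside `Λ` ever visits `K`. -/
noncomputable def hitP {d : ℕ} (K Λ : Set (Zd d)) (x : Zd d) : ℝ := ⨆ n, hitN K Λ n x

lemma hitN_nonneg {d : ℕ} (K Λ : Set (Zd d)) (n : ℕ) (x : Zd d) : 0 ≤ hitN K Λ n x := by
  induction n generalizing x with
  | zero => simp only [hitN]; split_ifs <;> norm_num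
  | succ n ih =>
    simp only [hitN]
    split_ifs
    · norm_num
    · exact div_nonneg (Finset.sum_nonneg fun _ _ => ih _) (by positivity)
    · norm_num

lemma hitN_le_one {d : ℕ} (hd : d ≠ 0) (K Λ : Set (Zd d)) (n : ℕ) (x : Zd d) :
    hitN K Λ n x ≤ 1 := by
  induction n generalizing x with
  | zero => simp only [hitN]; split_ifs <;> norm_num
  | succ n ih =>
    simp only [hitN]
    split_ifs
    · norm_num
    · exact (avg_mono ih x).trans_eq (avg_const hd 1 x)
    · norm_num

lemma hitN_mono {d : ℕ} (K Λ : Set (Zd d)) (x : Zd d) : Monotone fun n => hitN K Λ n x := by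
  refine monotone_nat_of_le_succ fun n => ?_
  induction n generalizing x with
  | zero =>
    by_cases h : x ∈ K
    · simp [hitN, h]
    · simpa [hitN, h] using hitN_nonneg K Λ 1 x
  | succ n ih =>
    rw [hitN, hitN]
    split_ifs
    · exact le_rfl
    · exact avg_mono ih x
    · exact le_rfl

lemma hitN_mono_region {d : ℕ} (K : Set (Zd d)) {Λ Λ' : Set (Zd d)} (h : Λ ⊆ Λ') (n : ℕ)
    (x : Zd d) : hitN K Λ n x ≤ hitN K Λ' n x := by
  induction n generalizing x with
  | zero => simp [hitN]
  | succ n ih =>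
    rw [hitN, hitN]
    split_ifs with h1 h2 h3 h3
    · exact le_rfl
    · exact avg_mono ih x
    · exact absurd (h h2) h3
    · exact div_nonneg (Finset.sum_nonneg fun _ _ => hitN_nonneg _ _ _ _) (by positivity)
    · exact le_rfl

lemma hitN_bddAbove {d : ℕ} (hd : d ≠ 0) (K Λ : Set (Zd d)) (x : Zd d) :
    BddAbove (Set.range fun n => hitN K Λ n x) :=
  ⟨1, by rintro _ ⟨n, rfl⟩; exact hitN_le_one hd K Λ n x⟩

lemma tendsto_hitN {d : ℕ} (hd : d ≠ 0) (K Λ : Set (Zd d)) (x : Zd d) :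
    Tendsto (fun n => hitN K Λ n x) atTop (nhds (hitP K Λ x)) :=
  tendsto_atTop_ciSup (hitN_mono K Λ x) (hitN_bddAbove hd K Λ x)

lemma tendsto_avg {d : ℕ} {ι : Type*} {l : Filter ι} {f : ι → Zd d → ℝ} {g : Zd d → ℝ}
    (h : ∀ x, Tendsto (fun n => f n x) l (nhds (g x))) (x : Zd d) :
    Tendsto (fun n => avg (f n) x) l (nhds (avg g x)) :=
  (tendsto_finsetSum _ fun _ _ => h _).div_const _

lemma hitP_of_mem {d : ℕ} (K Λ : Set (Zd d)) {x : Zd d} (h : x ∈ K) : hitP K Λ x = 1 := by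
  have : ∀ n, hitN K Λ n x = 1 := by rintro (_ | n) <;> simp [hitN, h]
  simp [hitP, this]

lemma hitP_of_mem_region {d : ℕ} (hd : d ≠ 0) (K Λ : Set (Zd d)) {x : Zd d} (h : x ∉ K)
    (h' : x ∈ Λ) : hitP K Λ x = avg (hitP K Λ) x := by
  have h1 := (tendsto_hitN hd K Λ x).comp (tendsto_add_atTop_nat 1)
  refine tendsto_nhds_unique h1 ?_
  refine (tendsto_avg (fun y => tendsto_hitN hd K Λ y) x).congr fun n => ?_
  simp [hitN, h, h']

lemma hitP_of_notMem {d : ℕ} (K Λ : Set (Zd d)) {x : Zd d} (h : x ∉ K) (h' : x ∉ Λ) :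
    hitP K Λ x = 0 := by
  have : ∀ n, hitN K Λ n x = 0 := by rintro (_ | n) <;> simp [hitN, h, h']
  simp [hitP, this]

lemma step_not {d : ℕ} (i : Fin d) (b : Bool) : step (i, !b) = -step (i, b) := by
  cases b <;> simp [step, ← Pi.single_neg]

lemma sum_mul_avg_comm {d : ℕ} (Λ : Finset (Zd d)) {f g : Zd d → ℝ} (hf : ∀ x ∉ Λ, f x = 0)
    (hg : ∀ x ∉ Λ, g x = 0) : ∑ x ∈ Λ, avg f x * g x = ∑ x ∈ Λ, avg g x * f x := by
  have key : ∀ v : Dir d, ∑ x ∈ Λ, f (x + step v) * g x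
      = ∑ x ∈ Λ, g (x + step (v.1, !v.2)) * f x := by
    intro v
    rw [← tsum_eq_sum (L := SummationFilter.unconditional _)
        (f := fun x => f (x + step v) * g x) fun x hx => by simp [hg x hx],
      ← tsum_eq_sum (L := SummationFilter.unconditional _)
        (f := fun x => g (x + step (v.1, !v.2)) * f x) fun x hx => by simp [hf x hx],
      ← (Equiv.addRight (step v)).tsum_eq fun x => g (x + step (v.1, !v.2)) * f x]
    refine tsum_congr fun x => ?_
    rw [step_not]
    simp [mul_comm]
  simp only [avg, div_mul_eq_mul_div, Finset.sum_mul, ← Finset.sum_div]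
  congr 1
  rw [Finset.sum_comm, Finset.sum_comm (s := Λ)]
  rw [Finset.sum_congr rfl fun v _ => key v]
  refine Fintype.sum_equiv ((Equiv.refl _).prodCongr Equiv.boolNot) _ _ fun v => ?_
  rcases v with ⟨i, b⟩
  simp [Equiv.boolNot]

lemma sweep_killed {d : ℕ} (hd : d ≠ 0) {B X Λ : Finset (Zd d)} (hBX : B ⊆ X) (hX : X ⊆ Λ) :
    ∑ x ∈ X, (1 - avg (hitP ↑X ↑Λ) x) * hitP ↑B ↑Λ x
      = ∑ x ∈ B, (1 - avg (hitP ↑B ↑Λ) x) := by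
  have zero : ∀ K ⊆ Λ, ∀ x ∉ Λ, hitP (K : Set (Zd d)) Λ x = 0 := fun K hK x hx =>
    hitP_of_notMem _ _ (fun h => hx (hK h)) hx
  have restr : ∀ K ⊆ Λ, ∀ g : Zd d → ℝ, ∑ x ∈ K, (1 - avg (hitP (K : Set (Zd d)) Λ) x) * g x
      = ∑ x ∈ Λ, (hitP (K : Set (Zd d)) Λ x - avg (hitP (K : Set (Zd d)) Λ) x) * g x := by
    intro K hK g
    rw [← Finset.sum_subset hK]
    · refine Finset.sum_congr rfl fun x hx => ?_
      rw [hitP_of_mem _ _ (Finset.mem_coe.2 hx)]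
    · intro x hx hxK
      rw [← hitP_of_mem_region hd _ _ (by simpa using hxK) (by simpa using hx)]
      simp
  have hB : ∑ x ∈ B, (1 - avg (hitP ↑B ↑Λ) x)
      = ∑ x ∈ B, (1 - avg (hitP ↑B ↑Λ) x) * hitP (X : Set (Zd d)) Λ x :=
    Finset.sum_congr rfl fun x hx => by
      rw [hitP_of_mem (X : Set (Zd d)) _ (Finset.mem_coe.2 (hBX hx)), mul_one]
  rw [hB, restr X hX, restr B (hBX.trans hX)]
  simp only [sub_mul, Finset.sum_sub_distrib]
  rw [sum_mul_avg_comm Λ (zero X hX) (zero B (hBX.trans hX))]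
  congr 1
  exact Finset.sum_congr rfl fun x _ => mul_comm _ _

/-- The box `[-R, R]^d`. -/
noncomputable def cube (d R : ℕ) : Finset (Zd d) := Finset.Icc (fun _ => -(R : ℤ)) fun _ => (R : ℤ)

lemma eventually_mem_cube {d : ℕ} (x : Zd d) : ∀ᶠ R : ℕ in atTop, x ∈ cube d R := by
  have : ∀ i, ∀ᶠ R : ℕ in atTop, |x i| ≤ R := fun i => by
    filter_upwards [eventually_ge_atTop (x i).natAbs] with R hR
    have := Int.natCast_natAbs (x i)
    omega
  filter_upwards [eventually_all.2 this] with R hR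
  exact Finset.mem_Icc.2 ⟨fun i => (abs_le.1 (hR i)).1, fun i => (abs_le.1 (hR i)).2⟩

lemma eventually_hitN_cube {d : ℕ} (K : Set (Zd d)) (n : ℕ) (x : Zd d) :
    ∀ᶠ R : ℕ in atTop, hitN K (cube d R) n x = hitN K Set.univ n x := by
  induction n generalizing x with
  | zero => simp [hitN]
  | succ n ih =>
    filter_upwards [eventually_mem_cube x, eventually_all.2 fun v : Dir d => ih (x + step v)]
      with R h1 h2
    simp [hitN, h1, avg, h2]

lemma hitP_mono_region {d : ℕ} (hd : d ≠ 0) (K : Set (Zd d)) {Λ Λ' : Set (Zd d)} (h : Λ ⊆ Λ')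
    (x : Zd d) : hitP K Λ x ≤ hitP K Λ' x :=
  ciSup_mono (hitN_bddAbove hd K Λ' x) fun n => hitN_mono_region K h n x

lemma tendsto_hitP_cube {d : ℕ} (hd : d ≠ 0) (K : Set (Zd d)) (x : Zd d) :
    Tendsto (fun R : ℕ => hitP K (cube d R) x) atTop (nhds (hitP K Set.univ x)) := by
  refine tendsto_order.2 ⟨fun a ha => ?_, fun a ha => ?_⟩
  · obtain ⟨n, hn⟩ := exists_lt_of_lt_ciSup ha
    filter_upwards [eventually_hitN_cube K n x] with R hR
    rw [← hR] at hn
    exact hn.trans_le (le_ciSup (hitN_bddAbove hd K (cube d R) x) n)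
  · exact Eventually.of_forall fun R =>
      (hitP_mono_region hd K (Set.subset_univ _) x).trans_lt ha

/-- The equilibrium measure of `X` sweeps to that of each subset `B`. -/
lemma sweep {d : ℕ} (hd : d ≠ 0) {B X : Finset (Zd d)} (hBX : B ⊆ X) :
    ∑ x ∈ X, (1 - avg (hitP ↑X Set.univ) x) * hitP ↑B Set.univ x
      = ∑ x ∈ B, (1 - avg (hitP ↑B Set.univ) x) := by
  have hlim : ∀ K : Set (Zd d), ∀ x, Tendsto (fun R : ℕ => 1 - avg (hitP K (cube d R)) x) atTop
      (nhds (1 - avg (hitP K Set.univ) x)) := fun K x =>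
    (tendsto_avg (fun y => tendsto_hitP_cube hd K y) x).const_sub 1
  refine tendsto_nhds_unique_of_eventuallyEq
    (tendsto_finsetSum _ fun x _ => (hlim X x).mul (tendsto_hitP_cube hd B x))
    (tendsto_finsetSum _ fun x _ => hlim B x) ?_
  have : ∀ᶠ R : ℕ in atTop, X ⊆ cube d R := by
    filter_upwards [(eventually_all_finset X).2 fun x _ => eventually_mem_cube x] with R hR
    exact hR
  filter_upwards [this] with R hR
  exact sweep_killed hd hBX hR

/-! ### Finite paths of the walk -/

/-- Position at time `k` of the path started at `x` whose successive steps are given by a list. -/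
def pos {d : ℕ} : Zd d → List (Dir d) → ℕ → Zd d
  | x, [], _ => x
  | x, _ :: _, 0 => x
  | x, v :: l, k + 1 => pos (x + step v) l k

/-- The path started at `x` with the given steps visits `K`. -/
def Visits {d : ℕ} (K : Set (Zd d)) : Zd d → List (Dir d) → Prop
  | x, [] => x ∈ K
  | x, v :: l => x ∈ K ∨ Visits K (x + step v) l

/-- Expectation over `n` independent uniform steps. -/
noncomputable def meanN {d : ℕ} (n : ℕ) (F : List (Dir d) → ℝ) : ℝ :=
  (∑ s : Fin n → Dir d, F (List.ofFn s)) / (2 * d) ^ n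

@[simp] lemma pos_zero {d : ℕ} (x : Zd d) (l : List (Dir d)) : pos x l 0 = x := by
  cases l <;> rfl

@[simp] lemma pos_cons_succ {d : ℕ} (x : Zd d) (v : Dir d) (l : List (Dir d)) (k : ℕ) :
    pos x (v :: l) (k + 1) = pos (x + step v) l k := rfl

lemma visits_iff {d : ℕ} (K : Set (Zd d)) (x : Zd d) (l : List (Dir d)) :
    Visits K x l ↔ ∃ k ≤ l.length, pos x l k ∈ K := by
  induction l generalizing x with
  | nil => simp [Visits, pos]
  | cons v l ih =>
    rw [Visits, ih]
    constructor
    · rintro (h | ⟨k, hk, h⟩)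
      · exact ⟨0, by simp, by simpa using h⟩
      · exact ⟨k + 1, by simpa using hk, by simpa using h⟩
    · rintro ⟨_ | k, hk, h⟩
      · exact Or.inl (by simpa using h)
      · exact Or.inr ⟨k, by simpa using hk, by simpa using h⟩

lemma visits_biUnion {d : ℕ} {ι : Type*} [DecidableEq ι] (S : Finset ι) (F : ι → Finset (Zd d))
    (x : Zd d) (l : List (Dir d)) :
    Visits (S.biUnion F : Finset (Zd d)) x l ↔ ∃ c ∈ S, Visits (F c : Set (Zd d)) x l := by
  simp only [visits_iff, Finset.mem_coe, Finset.mem_biUnion]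
  constructor
  · rintro ⟨k, hk, c, hc, h⟩
    exact ⟨c, hc, k, hk, h⟩
  · rintro ⟨c, hc, k, hk, h⟩
    exact ⟨k, hk, c, hc, h⟩

lemma meanN_zero {d : ℕ} (F : List (Dir d) → ℝ) : meanN 0 F = F [] := by
  simp [meanN]

lemma meanN_succ {d : ℕ} (n : ℕ) (F : List (Dir d) → ℝ) :
    meanN (n + 1) F = (∑ v : Dir d, meanN n fun l => F (v :: l)) / (2 * d) := by
  unfold meanN
  rw [← Finset.sum_div, div_div, ← pow_succ]
  congr 1
  rw [← (Fin.consEquiv fun _ => Dir d).sum_comp, Fintype.sum_prod_type]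
  simp [Fin.consEquiv, List.ofFn_succ]

lemma meanN_sub {d : ℕ} (n : ℕ) (F G : List (Dir d) → ℝ) :
    meanN n (fun l => F l - G l) = meanN n F - meanN n G := by
  simp [meanN, sub_div]

lemma meanN_mono {d : ℕ} (n : ℕ) {F G : List (Dir d) → ℝ} (h : ∀ l, F l ≤ G l) :
    meanN n F ≤ meanN n G := by
  unfold meanN
  gcongr
  exact h _

lemma meanN_const {d : ℕ} (hd : d ≠ 0) (n : ℕ) (c : ℝ) :
    meanN n (fun _ : List (Dir d) => c) = c := by
  have : (d : ℝ) ≠ 0 := by exact_mod_cast hd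
  simp only [meanN, Finset.sum_const, Finset.card_univ, Fintype.card_fun, Fintype.card_prod,
    Fintype.card_fin, Fintype.card_bool, nsmul_eq_mul]
  push_cast
  rw [mul_comm (d : ℝ) 2]
  field_simp

open Classical in
lemma hitN_eq_meanN {d : ℕ} (hd : d ≠ 0) (K : Set (Zd d)) (n : ℕ) (x : Zd d) :
    hitN K Set.univ n x = meanN n fun l => if Visits K x l then 1 else 0 := by
  induction n generalizing x with
  | zero =>
    by_cases h : x ∈ K <;> simp [hitN, meanN_zero, Visits, h]
  | succ n ih =>
    by_cases hx : x ∈ K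
    · rw [meanN_succ]
      simp only [Visits, hx, hitN, true_or, if_true]
      exact (avg_const hd 1 x).symm.trans (by simp [avg, meanN_const hd])
    · simp [Visits, hx, hitN, avg, ih, meanN_succ]

lemma adj_add_step {d : ℕ} (x : Zd d) (v : Dir d) : adj x (x + step v) := by
  have : ∀ i, |x i - (x + step v) i| = if i = v.1 then 1 else 0 := by
    intro i
    by_cases h : i = v.1
    · subst h
      cases hv : v.2 <;> simp [step, hv]
    · simp [step, h]
  rw [adj, Finset.sum_congr rfl fun i _ => this i]
  simp

lemma adj_pos {d : ℕ} (x : Zd d) (l : List (Dir d)) {k : ℕ} (hk : k < l.length) :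
    adj (pos x l k) (pos x l (k + 1)) := by
  induction l generalizing x k with
  | nil => simp at hk
  | cons v l ih =>
    cases k with
    | zero => simpa using adj_add_step x v
    | succ k => simpa using ih (x + step v) (by simpa using hk)

lemma step_injective {d : ℕ} : Function.Injective (step : Dir d → Zd d) := by
  rintro ⟨i, b⟩ ⟨j, b'⟩ h
  have hij : i = j := by
    by_contra hij
    have := congrFun h i
    cases b <;> simp [step, hij] at this
  subst hij
  have := congrFun h i
  cases b <;> cases b' <;> simp [step] at this ⊢

lemma eq_of_pos_eq {d : ℕ} (x : Zd d) {l l' : List (Dir d)} (hl : l.length = l'.length)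
    (h : ∀ k ≤ l.length, pos x l k = pos x l' k) : l = l' := by
  induction l generalizing x l' with
  | nil => exact (List.length_eq_zero_iff.1 hl.symm).symm
  | cons v l ih =>
    cases l' with
    | nil => simp at hl
    | cons v' l' =>
      have hv : v = v' := by
        have := h (0 + 1) (by simp)
        simp only [pos_cons_succ, pos_zero, add_right_inj] at this
        exact step_injective this
      subst hv
      rw [ih (x + step v) (by simpa using hl) fun k hk => by simpa using h (k + 1) (by simpa)]

lemma measurableSet_prefix {d : ℕ} (p : ℕ → Prop) (s : ℕ → Set (Zd d)) :
    MeasurableSet {ω : ℕ → Zd d | ∀ k, p k → ω k ∈ s k} := by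
  have : {ω : ℕ → Zd d | ∀ k, p k → ω k ∈ s k} = ⋂ k, ⋂ _ : p k, (fun ω => ω k) ⁻¹' s k := by
    ext; simp
  rw [this]
  exact MeasurableSet.iInter fun k => MeasurableSet.iInter fun _ =>
    measurable_pi_apply k (Set.to_countable _).measurableSet

open Classical in
/-- Events depending on the first `n` steps have the probabilities of uniform sequences of steps. -/
lemma srw_real_eq_meanN {d : ℕ} (hd : d ≠ 0) {P : Zd d → Measure (ℕ → Zd d)} (hP : IsSRW d P)
    (n : ℕ) (x : Zd d) {E : Set (ℕ → Zd d)} (hE : MeasurableSet E) (p : List (Dir d) → Prop)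
    (hp : ∀ l : List (Dir d), l.length = n → ∀ ω : ℕ → Zd d, (∀ k ≤ n, ω k = pos x l k) →
      (ω ∈ E ↔ p l)) :
    (P x).real E = meanN n fun l => if p l then 1 else 0 := by
  have := hP.1 x
  have hd' : (d : ℝ) ≠ 0 := by exact_mod_cast hd
  set C : (Fin n → Dir d) → Set (ℕ → Zd d) :=
    fun s => {ω | ∀ k ≤ n, ω k = pos x (List.ofFn s) k} with hC
  have hCm : ∀ s, MeasurableSet (C s) := fun s =>
    measurableSet_prefix (fun k => k ≤ n) fun k => {pos x (List.ofFn s) k}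
  have hCP : ∀ s, (P x).real (C s) = ((2 * d : ℝ) ^ n)⁻¹ := by
    intro s
    have := hP.2.1 x n (pos x (List.ofFn s))
      ⟨pos_zero _ _, fun k hk => adj_pos _ _ (by simpa using hk)⟩
    rw [Measure.real, hC, this, ENNReal.toReal_pow, ENNReal.toReal_inv, inv_pow]
    simp
  have hCd : Pairwise (Function.onFun Disjoint C) := by
    intro s s' hss
    refine Set.disjoint_left.2 fun ω h h' => hss ?_
    refine List.ofFn_injective (eq_of_pos_eq x (by simp) fun k hk => ?_)
    rw [List.length_ofFn] at hk
    rw [← h k hk, ← h' k hk]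
  have hU : (P x).real (⋃ s, C s) = 1 := by
    rw [measureReal_iUnion_fintype hCd hCm]
    rw [Finset.sum_congr rfl fun s _ => hCP s]
    simp only [Finset.sum_const, Finset.card_univ, Fintype.card_fun, Fintype.card_prod,
      Fintype.card_fin, Fintype.card_bool, nsmul_eq_mul]
    push_cast
    rw [mul_comm (d : ℝ) 2]
    field_simp
  have hU0 : (P x).real (⋃ s, C s)ᶜ = 0 := by
    rw [probReal_compl_eq_one_sub (MeasurableSet.iUnion hCm), hU, sub_self]
  have hz : (P x).real (E \ ⋃ s, C s) = 0 :=
    le_antisymm ((measureReal_mono fun ω h => h.2).trans_eq hU0) measureReal_nonneg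
  have hsplit : (P x).real E = (P x).real (⋃ s, E ∩ C s) := by
    rw [← measureReal_inter_add_sdiff (μ := P x) (s := E) (MeasurableSet.iUnion hCm),
      hz, add_zero, Set.inter_iUnion]
  rw [hsplit, measureReal_iUnion_fintype
    (fun s s' h => (hCd h).mono Set.inter_subset_right Set.inter_subset_right)
    fun s => hE.inter (hCm s)]
  unfold meanN
  rw [div_eq_mul_inv, Finset.sum_mul]
  refine Finset.sum_congr rfl fun s _ => ?_
  have hs := hp (List.ofFn s) (by simp)
  beta_reduce
  split_ifs with h
  · rw [show E ∩ C s = C s from Set.inter_eq_right.2 fun ω hω => (hs ω hω).2 h, hCP, one_mul]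
  · rw [show E ∩ C s = ∅ from Set.disjoint_iff_inter_eq_empty.1
      (Set.disjoint_left.2 fun ω h1 h2 => h ((hs ω h2).1 h1))]
    simp

lemma real_avoid_eq {d : ℕ} (hd : d ≠ 0) {P : Zd d → Measure (ℕ → Zd d)} (hP : IsSRW d P)
    (K : Set (Zd d)) (n : ℕ) (x : Zd d) :
    (P x).real {ω | ∀ k, 1 ≤ k ∧ k ≤ n + 1 → ω k ∈ Kᶜ} = 1 - avg (hitN K Set.univ n) x := by
  classical
  rw [srw_real_eq_meanN hd hP (n + 1) x (measurableSet_prefix _ fun _ => Kᶜ)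
    (fun l => ∀ k, 1 ≤ k ∧ k ≤ n + 1 → pos x l k ∈ Kᶜ)]
  · have h1 : ∀ v : Dir d, (meanN n fun l =>
        if ∀ k, 1 ≤ k ∧ k ≤ n + 1 → pos x (v :: l) k ∈ Kᶜ then (1 : ℝ) else 0)
        = 1 - hitN K Set.univ n (x + step v) := by
      intro v
      rw [hitN_eq_meanN hd]
      refine Eq.trans ?_ (congrArg (· - _) (meanN_const hd n 1))
      refine Eq.trans ?_ (meanN_sub n _ _)
      unfold meanN
      congr 1
      refine Finset.sum_congr rfl fun s _ => ?_
      have : (∀ k, 1 ≤ k ∧ k ≤ n + 1 → pos x (v :: List.ofFn s) k ∈ Kᶜ)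
          ↔ ¬ Visits K (x + step v) (List.ofFn s) := by
        rw [visits_iff]
        push Not
        rw [List.length_ofFn]
        constructor
        · intro h k hk
          exact h (k + 1) ⟨by omega, by omega⟩
        · rintro h (_ | k) hk
          · omega
          · exact h k (by omega)
      by_cases hv : Visits K (x + step v) (List.ofFn s)
      · simp only [if_neg (this.not.2 (not_not.2 hv)), if_pos hv, sub_self]
      · simp only [if_pos (this.2 hv), if_neg hv, sub_zero]
    rw [meanN_succ]
    simp only [h1]
    have hd' : (d : ℝ) ≠ 0 := by exact_mod_cast hd
    simp [avg, sub_div]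
    field_simp
  · intro l _ ω h
    refine forall₂_congr fun k hk => ?_
    rw [h k hk.2]

lemma eqm_eq {d : ℕ} (hd : d ≠ 0) {P : Zd d → Measure (ℕ → Zd d)} (hP : IsSRW d P)
    (K : Set (Zd d)) {x : Zd d} (hx : x ∈ K) : eqm P K x = 1 - avg (hitP K Set.univ) x := by
  have := hP.1 x
  rw [eqm, Set.indicator_of_mem hx]
  have h1 : {ω : ℕ → Zd d | ∀ n, 1 ≤ n → ω n ∉ K}
      = ⋂ n : ℕ, {ω | ∀ k, 1 ≤ k ∧ k ≤ n + 1 → ω k ∈ Kᶜ} := by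
    ext ω
    simp only [Set.mem_ofPred_eq, Set.mem_iInter]
    exact ⟨fun h n k hk => h k hk.1, fun h n hn => h n n ⟨hn, by omega⟩⟩
  have h2 := tendsto_measure_iInter_atTop (μ := P x)
    (s := fun n : ℕ => {ω : ℕ → Zd d | ∀ k, 1 ≤ k ∧ k ≤ n + 1 → ω k ∈ Kᶜ})
    (fun n => (measurableSet_prefix _ fun _ => Kᶜ).nullMeasurableSet)
    (fun m n hmn ω hω k hk => hω k ⟨hk.1, by omega⟩) ⟨0, measure_ne_top _ _⟩
  rw [← h1] at h2
  have h3 := (ENNReal.tendsto_toReal (measure_ne_top _ _)).comp h2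
  refine tendsto_nhds_unique h3 ?_
  refine ((tendsto_avg (fun y => tendsto_hitN hd K Set.univ y) x).const_sub 1).congr fun n => ?_
  exact (real_avoid_eq hd hP K n x).symm

lemma capa_eq {d : ℕ} (hd : d ≠ 0) {P : Zd d → Measure (ℕ → Zd d)} (hP : IsSRW d P)
    (K : Finset (Zd d)) : capa P K = ∑ x ∈ K, (1 - avg (hitP ↑K Set.univ) x) :=
  Finset.sum_congr rfl fun _ hx => eqm_eq hd hP K (Finset.mem_coe.2 hx)

/-! ### The number of separated sets visited by a walk -/

open Classical in
/-- The labels `c ∈ A` for which the path visits `F c`. -/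
noncomputable def visited {d : ℕ} {ι : Type*} (A : Finset ι) (F : ι → Finset (Zd d)) (x : Zd d)
    (l : List (Dir d)) : Finset ι :=
  A.filter fun c => Visits (F c : Set (Zd d)) x l

/-- Nonnegative superharmonic functions `p c`, at least `1` on `F c`, whose sum over the other
labels is at most `ε` on `F c`. -/
structure Separated {d : ℕ} {ι : Type*} [DecidableEq ι] (A : Finset ι) (F : ι → Finset (Zd d))
    (p : ι → Zd d → ℝ) (ε : ℝ) : Prop where
  nonneg : ∀ c x, 0 ≤ p c x
  superharmonic : ∀ c x, avg (p c) x ≤ p c x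
  one_le : ∀ c, ∀ x ∈ F c, 1 ≤ p c x
  sum_le : ∀ c ∈ A, ∀ x ∈ F c, ∑ c' ∈ A.erase c, p c' x ≤ ε

lemma avg_add_sum_le {d : ℕ} (hd : d ≠ 0) {ι : Type*} (T : Finset ι) {p : ι → Zd d → ℝ}
    (hp : ∀ c x, avg (p c) x ≤ p c x) {a b : ℝ} (ha : 0 ≤ a) (hb : 0 ≤ b) (x : Zd d) :
    avg (fun y => a * (1 + b * ∑ c ∈ T, p c y)) x ≤ a * (1 + b * ∑ c ∈ T, p c x) := by
  have hd' : (d : ℝ) ≠ 0 := by exact_mod_cast hd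
  have : avg (fun y => a * (1 + b * ∑ c ∈ T, p c y)) x
      = a * (1 + b * ∑ c ∈ T, avg (p c) x) := by
    simp only [avg, ← Finset.mul_sum, Finset.sum_add_distrib, ← Finset.sum_div]
    rw [Finset.sum_comm]
    simp
    field_simp
  rw [this]
  gcongr with c
  exact hp c x

lemma Separated.label_eq {d : ℕ} {ι : Type*} [DecidableEq ι] {A : Finset ι}
    {F : ι → Finset (Zd d)} {p : ι → Zd d → ℝ} {ε : ℝ} (h : Separated A F p ε) (hε : ε < 1)
    {c c' : ι} (hc : c ∈ A) (hc' : c' ∈ A) {x : Zd d} (hx : x ∈ F c) (hx' : x ∈ F c') :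
    c = c' := by
  by_contra hne
  have h1 := h.sum_le c hc x hx
  have h2 := Finset.single_le_sum (f := fun c' => p c' x) (fun c' _ => h.nonneg c' x)
    (Finset.mem_erase.2 ⟨Ne.symm hne, hc'⟩)
  have h3 := h.one_le c' x hx'
  linarith

lemma Separated.weight_insert_le {d : ℕ} {ι : Type*} [DecidableEq ι] {A : Finset ι}
    {F : ι → Finset (Zd d)} {p : ι → Zd d → ℝ} {ε z : ℝ} (h : Separated A F p ε) (hz : 1 ≤ z)
    (hε : ε * (4 * z) ≤ 1) {V : Finset ι} {c : ι} (hc : c ∈ A) {x : Zd d}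
    (hx : x ∈ F c) :
    z ^ (insert c V).card * (1 + 2 * z * ∑ c' ∈ A \ insert c V, p c' x)
      ≤ z ^ V.card * (1 + 2 * z * ∑ c' ∈ A \ V, p c' x) := by
  by_cases hcV : c ∈ V
  · rw [Finset.insert_eq_of_mem hcV]
  · rw [Finset.card_insert_of_notMem hcV, pow_succ, mul_assoc]
    refine mul_le_mul_of_nonneg_left ?_ (by positivity)
    have h1 : ∑ c' ∈ A \ insert c V, p c' x ≤ ε := by
      refine (Finset.sum_le_sum_of_subset_of_nonneg ?_ fun c' _ _ => h.nonneg c' x).trans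
        (h.sum_le c hc x hx)
      intro c' hc'
      simp only [Finset.mem_sdiff, Finset.mem_insert, not_or] at hc'
      exact Finset.mem_erase.2 ⟨hc'.2.1, hc'.1⟩
    have h2 : 1 ≤ ∑ c' ∈ A \ V, p c' x :=
      (h.one_le c x hx).trans (Finset.single_le_sum (f := fun c' => p c' x)
        (fun c' _ => h.nonneg c' x) (Finset.mem_sdiff.2 ⟨hc, hcV⟩))
    have h3 : 2 * z * ∑ c' ∈ A \ insert c V, p c' x ≤ 1 / 2 := by nlinarith
    have h4 : 2 * z * 1 ≤ 2 * z * ∑ c' ∈ A \ V, p c' x := by gcongr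
    nlinarith

lemma Separated.weight_union_le {d : ℕ} {ι : Type*} [DecidableEq ι] {A : Finset ι}
    {F : ι → Finset (Zd d)} {p : ι → Zd d → ℝ} {ε z : ℝ} (h : Separated A F p ε) (hz : 1 ≤ z)
    (hε : ε * (4 * z) ≤ 1) (V : Finset ι) (x : Zd d) :
    z ^ (V ∪ A.filter (x ∈ F ·)).card * (1 + 2 * z * ∑ c ∈ A \ (V ∪ A.filter (x ∈ F ·)), p c x)
      ≤ z ^ V.card * (1 + 2 * z * ∑ c ∈ A \ V, p c x) := by
  have hε1 : ε < 1 := by nlinarith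
  rcases (A.filter (x ∈ F ·)).eq_empty_or_nonempty with h0 | ⟨c, hc⟩
  · rw [h0, Finset.union_empty]
  · obtain ⟨hcA, hcx⟩ := Finset.mem_filter.1 hc
    have : A.filter (x ∈ F ·) = {c} := by
      refine Finset.eq_singleton_iff_unique_mem.2 ⟨hc, fun c' hc' => ?_⟩
      obtain ⟨hcA', hcx'⟩ := Finset.mem_filter.1 hc'
      exact h.label_eq hε1 hcA' hcA hcx' hcx
    rw [this, Finset.union_comm, ← Finset.insert_eq]
    exact h.weight_insert_le hz hε hcA hcx

lemma Separated.meanN_pow_le {d : ℕ} (hd : d ≠ 0) {ι : Type*} [DecidableEq ι] {A : Finset ι}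
    {F : ι → Finset (Zd d)} {p : ι → Zd d → ℝ} {ε z : ℝ} (h : Separated A F p ε) (hz : 1 ≤ z)
    (hε : ε * (4 * z) ≤ 1) (n : ℕ) (V : Finset ι) (x : Zd d) :
    meanN n (fun l => z ^ (V ∪ visited A F x l).card)
      ≤ z ^ V.card * (1 + 2 * z * ∑ c ∈ A \ V, p c x) := by
  classical
  induction n generalizing V x with
  | zero =>
    set m : Finset ι := A.filter (x ∈ F ·) with hm
    have : visited A F x [] = m := by
      ext c; simp [visited, hm, Visits]
    rw [meanN_zero, this]
    refine le_trans ?_ (h.weight_union_le hz hε V x)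
    refine le_mul_of_one_le_right (by positivity) ?_
    have := Finset.sum_nonneg fun c (_ : c ∈ A \ (V ∪ m)) => h.nonneg c x
    nlinarith
  | succ n ih =>
    set m : Finset ι := A.filter (x ∈ F ·) with hm
    refine le_trans ?_ (h.weight_union_le hz hε V x)
    refine le_trans ?_ (avg_add_sum_le hd (A \ (V ∪ m)) h.superharmonic (a := z ^ (V ∪ m).card)
      (b := 2 * z) (by positivity) (by positivity) x)
    rw [meanN_succ, avg]
    gcongr with v
    have hu : ∀ l, V ∪ visited A F x (v :: l) = V ∪ m ∪ visited A F (x + step v) l := by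
      intro l
      ext c
      simp only [visited, hm, Visits, Finset.mem_union, Finset.mem_filter, Finset.mem_coe]
      tauto
    simp only [hu]
    exact ih (V ∪ m) (x + step v)

lemma Separated.meanN_pow_le_of_mem {d : ℕ} (hd : d ≠ 0) {ι : Type*} [DecidableEq ι]
    {A : Finset ι} {F : ι → Finset (Zd d)} {p : ι → Zd d → ℝ} {ε z : ℝ} (h : Separated A F p ε)
    (hz : 1 ≤ z) (hε : ε * (4 * z) ≤ 1) (n : ℕ) {c : ι} (hc : c ∈ A) {x : Zd d} (hx : x ∈ F c) :
    meanN n (fun l => z ^ (visited A F x l).card) ≤ 2 * z := by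
  refine (meanN_mono n fun l => pow_le_pow_right₀ hz
    (Finset.card_le_card (Finset.subset_union_right (s₁ := {c})))).trans ?_
  refine (h.meanN_pow_le hd hz hε n {c} x).trans ?_
  have := h.sum_le c hc x hx
  rw [Finset.card_singleton, pow_one, ← Finset.erase_eq]
  have h3 : 2 * z * ∑ c' ∈ A.erase c, p c' x ≤ 1 / 2 := by nlinarith
  nlinarith

/-! ### Unions of Poisson families of sets -/

lemma alternating_sum_le {ι κ : Type*} [DecidableEq ι] (J : Finset κ) (w : κ → ℝ)
    (hw : ∀ j ∈ J, 0 ≤ w j)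
    (a : κ → Finset ι) {z : ℝ} (hz : 1 ≤ z) (U : Finset ι) :
    ∑ S ∈ U.powerset, (-1 : ℝ) ^ S.card *
        Real.exp (-∑ j ∈ J, w j * if (a j ∩ S).Nonempty then 1 else 0)
      ≤ (z ^ U.card)⁻¹ * Real.exp (∑ j ∈ J, w j * (z ^ (a j).card - 1)) := by
  classical
  have hz0 : 0 < z := by linarith
  induction J using Finset.induction_on generalizing U with
  | empty =>
    have h := Finset.sum_powerset_neg_one_pow_card (x := U)
    have h' : ∑ S ∈ U.powerset, (-1 : ℝ) ^ S.card = if U = ∅ then 1 else 0 := by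
      exact_mod_cast h
    simp only [Finset.sum_empty, neg_zero, Real.exp_zero, mul_one, h']
    split_ifs with hU
    · simp [hU]
    · positivity
  | insert j J hj ih =>
    have hwj := hw j (Finset.mem_insert_self j J)
    have ih' := ih fun k hk => hw k (Finset.mem_insert_of_mem hk)
    set f : Finset ι → ℝ := fun S => (-1 : ℝ) ^ S.card *
        Real.exp (-∑ k ∈ J, w k * if (a k ∩ S).Nonempty then 1 else 0) with hf
    set e := Real.exp (-w j) with he
    have he1 : e ≤ 1 := Real.exp_le_one_iff.2 (by linarith)
    have he0 : 0 < e := Real.exp_pos _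
    have hsum : ∑ S ∈ U.powerset, (-1 : ℝ) ^ S.card *
        Real.exp (-∑ k ∈ insert j J, w k * if (a k ∩ S).Nonempty then 1 else 0)
        = e * ∑ S ∈ U.powerset, f S + (1 - e) * ∑ S ∈ (U \ a j).powerset, f S := by
      have hsub : (U \ a j).powerset = U.powerset.filter fun S => ¬ (a j ∩ S).Nonempty := by
        ext S
        simp only [Finset.mem_powerset, Finset.mem_filter, Finset.not_nonempty_iff_eq_empty,
          ← Finset.disjoint_iff_inter_eq_empty, Finset.subset_sdiff]
        exact and_congr_right fun _ => disjoint_comm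
      rw [hsub, Finset.sum_filter, Finset.mul_sum, Finset.mul_sum, ← Finset.sum_add_distrib]
      refine Finset.sum_congr rfl fun S _ => ?_
      rw [Finset.sum_insert hj, neg_add, Real.exp_add]
      by_cases hS : (a j ∩ S).Nonempty
      · simp only [hS, hf, he, if_true, not_true, if_false]; ring_nf
      · simp only [hS, hf, he, if_false, not_false_eq_true, if_true, mul_zero, neg_zero,
          Real.exp_zero]
        ring
    rw [hsum, Finset.sum_insert hj, Real.exp_add]
    set G := Real.exp (∑ k ∈ J, w k * (z ^ (a k).card - 1)) with hG
    have hG0 : 0 < G := Real.exp_pos _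
    set Z := z ^ (a j).card with hZ
    have hZ1 : 1 ≤ Z := one_le_pow₀ hz
    have hcard : (z ^ (U \ a j).card)⁻¹ ≤ (z ^ U.card)⁻¹ * Z := by
      rw [inv_le_iff_one_le_mul₀ (by positivity), ← div_eq_inv_mul, div_mul_eq_mul_div,
        le_div_iff₀ (by positivity), one_mul, hZ, ← pow_add]
      refine pow_le_pow_right₀ hz ?_
      rw [add_comm]
      exact Nat.sub_le_iff_le_add.1 (Finset.le_card_sdiff _ _)
    have hexp : e + (1 - e) * Z ≤ Real.exp (w j * (Z - 1)) := by
      have h1 := Real.add_one_le_exp (-w j)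
      have h2 := Real.add_one_le_exp (w j * (Z - 1))
      nlinarith
    calc e * ∑ S ∈ U.powerset, f S + (1 - e) * ∑ S ∈ (U \ a j).powerset, f S
        ≤ e * ((z ^ U.card)⁻¹ * G) + (1 - e) * ((z ^ U.card)⁻¹ * Z * G) := by
          exact add_le_add (mul_le_mul_of_nonneg_left (ih' U) he0.le)
            (mul_le_mul_of_nonneg_left ((ih' (U \ a j)).trans (by gcongr)) (by linarith))
      _ = (z ^ U.card)⁻¹ * ((e + (1 - e) * Z) * G) := by ring
      _ ≤ (z ^ U.card)⁻¹ * (Real.exp (w j * (Z - 1)) * G) := by gcongr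

lemma measureReal_avoid_eq_sum {Ω ι : Type*} [MeasurableSpace Ω] [DecidableEq ι] (Q : Measure Ω)
    [IsFiniteMeasure Q] (V : ι → Set Ω) (hV : ∀ c, MeasurableSet (V c)) (A : Finset ι)
    (G : Set Ω) (hG : MeasurableSet G) :
    Q.real (G ∩ {ω | ∀ c ∈ A, ω ∉ V c})
      = ∑ S ∈ A.powerset, (-1 : ℝ) ^ S.card * Q.real (G ∩ {ω | ∀ c ∈ S, ω ∈ V c}) := by
  induction A using Finset.induction_on generalizing G with
  | empty => simp
  | insert c A hc ih =>
    have h1 := ih G hG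
    have h2 := ih (G ∩ V c) (hG.inter (hV c))
    have h3 := measureReal_inter_add_sdiff (μ := Q) (s := G ∩ {ω | ∀ c ∈ A, ω ∉ V c}) (hV c)
    have h4 : (G ∩ {ω | ∀ c ∈ A, ω ∉ V c}) \ V c = G ∩ {ω | ∀ c' ∈ insert c A, ω ∉ V c'} := by
      ext ω; simp; tauto
    have h5 : G ∩ {ω | ∀ c ∈ A, ω ∉ V c} ∩ V c = G ∩ V c ∩ {ω | ∀ c ∈ A, ω ∉ V c} := by
      ext ω; simp; tauto
    rw [h4, h5] at h3
    rw [Finset.sum_powerset_insert hc, ← h1]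
    have h6 : ∑ S ∈ A.powerset, (-1 : ℝ) ^ (insert c S).card
        * Q.real (G ∩ {ω | ∀ c' ∈ insert c S, ω ∈ V c'})
        = -Q.real (G ∩ V c ∩ {ω | ∀ c ∈ A, ω ∉ V c}) := by
      rw [h2, ← Finset.sum_neg_distrib]
      refine Finset.sum_congr rfl fun S hS => ?_
      rw [Finset.card_insert_of_notMem fun h => hc (Finset.mem_powerset.1 hS h), pow_succ]
      have : G ∩ {ω | ∀ c' ∈ insert c S, ω ∈ V c'} = G ∩ V c ∩ {ω | ∀ c ∈ S, ω ∈ V c} := by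
        ext ω; simp; tauto
      rw [this]; ring
    rw [h6]
    linarith

/-- All sets of a separated family are occupied with exponentially small probability. -/
lemma all_occupied_le {d : ℕ} (hd : d ≠ 0) {P : Zd d → Measure (ℕ → Zd d)} (hP : IsSRW d P)
    {u : ℝ} (hu : 0 ≤ u) {Q : Measure (Zd d → Bool)} (hQ : IsVacantLaw P u Q) {ι : Type*}
    [DecidableEq ι] {A : Finset ι} {F : ι → Finset (Zd d)} {p : ι → Zd d → ℝ} {ε z : ℝ}
    (h : Separated A F p ε) (hz : 1 ≤ z) (hε : ε * (4 * z) ≤ 1) :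
    Q.real {Y | ∀ c ∈ A, ∃ x ∈ F c, Y x = false}
      ≤ (z ^ A.card)⁻¹ * Real.exp (u * (2 * z) * (A.biUnion F).card) := by
  classical
  have := hQ.1
  set X := A.biUnion F with hX
  set e : Zd d → ℝ := fun x => 1 - avg (hitP ↑X Set.univ) x with he
  have he0 : ∀ x ∈ X, 0 ≤ e x ∧ e x ≤ 1 := by
    intro x hx
    have h1 := eqm_eq hd hP (X : Set (Zd d)) (Finset.mem_coe.2 hx)
    have := hP.1 x
    rw [he]
    simp only
    rw [← h1, eqm, Set.indicator_of_mem (Finset.mem_coe.2 hx)]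
    exact ⟨ENNReal.toReal_nonneg, measureReal_le_one⟩
  have hincl : Q.real {Y | ∀ c ∈ A, ∃ x ∈ F c, Y x = false}
      = ∑ S ∈ A.powerset, (-1 : ℝ) ^ S.card * Real.exp (-(u * capa P (S.biUnion F))) := by
    have h1 := measureReal_avoid_eq_sum Q (fun c => {Y : Zd d → Bool | ∀ x ∈ F c, Y x = true})
      (fun c => by measurability) A Set.univ MeasurableSet.univ
    have h2 : {Y : Zd d → Bool | ∀ c ∈ A, ∃ x ∈ F c, Y x = false}
        = Set.univ ∩ {Y | ∀ c ∈ A, Y ∉ {Y : Zd d → Bool | ∀ x ∈ F c, Y x = true}} := by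
      ext Y; simp
    rw [h2, h1]
    refine Finset.sum_congr rfl fun S _ => ?_
    have h3 : (Set.univ ∩ {Y | ∀ c ∈ S, Y ∈ {Y : Zd d → Bool | ∀ x ∈ F c, Y x = true}})
        = {Y | ∀ x ∈ S.biUnion F, Y x = true} := by
      ext Y
      simp only [Finset.mem_biUnion, Set.univ_inter, Set.mem_ofPred_eq]
      exact ⟨fun h x ⟨c, hc, hx⟩ => h c hc x hx, fun h c hc x hx => h x ⟨c, hc, hx⟩⟩
    rw [h3, Measure.real, hQ.2, ENNReal.toReal_ofReal (Real.exp_pos _).le]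
  have hlim : Tendsto (fun n => ∑ S ∈ A.powerset, (-1 : ℝ) ^ S.card *
      Real.exp (-(u * ∑ x ∈ X, e x * hitN (S.biUnion F : Finset (Zd d)) Set.univ n x))) atTop
      (nhds (∑ S ∈ A.powerset, (-1 : ℝ) ^ S.card * Real.exp (-(u * capa P (S.biUnion F))))) := by
    refine tendsto_finsetSum _ fun S hS => ?_
    have hSX : S.biUnion F ⊆ X := Finset.biUnion_subset_biUnion_of_subset_left F
      (Finset.mem_powerset.1 hS)
    rw [capa_eq hd hP, ← sweep hd hSX]
    refine Tendsto.const_mul _ (Real.continuous_exp.continuousAt.tendsto.comp ?_)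
    exact ((tendsto_finsetSum _ fun x _ => (tendsto_hitN hd _ _ x).const_mul _).const_mul u).neg
  rw [hincl]
  refine le_of_tendsto' hlim fun n => ?_
  set J : Finset (Zd d × (Fin n → Dir d)) := X ×ˢ Finset.univ with hJ
  set w : Zd d × (Fin n → Dir d) → ℝ := fun j => u * (e j.1 / (2 * d) ^ n) with hw
  set a : Zd d × (Fin n → Dir d) → Finset ι := fun j => visited A F j.1 (List.ofFn j.2) with ha
  have hsum : ∀ f : Zd d → List (Dir d) → ℝ,
      ∑ j ∈ J, w j * f j.1 (List.ofFn j.2) = u * ∑ x ∈ X, e x * meanN n (f x) := by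
    intro f
    rw [hJ, Finset.sum_product, Finset.mul_sum]
    refine Finset.sum_congr rfl fun x _ => ?_
    simp only [hw, meanN]
    rw [← Finset.mul_sum]
    ring
  have halt := alternating_sum_le J w (fun j hj => by
    have := (he0 j.1 (Finset.mem_product.1 hj).1).1
    positivity) a hz A
  refine le_trans (le_of_eq (Finset.sum_congr rfl fun S hS => ?_)) (halt.trans ?_)
  · rw [show (∑ j ∈ J, w j * if (a j ∩ S).Nonempty then 1 else 0) = _ from
      hsum fun x l => if (visited A F x l ∩ S).Nonempty then 1 else 0]
    congr 4
    refine Finset.sum_congr rfl fun x _ => ?_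
    rw [hitN_eq_meanN hd]
    congr 2
    ext l
    refine if_congr ?_ rfl rfl
    rw [visits_biUnion]
    constructor
    · rintro ⟨c, hc, hv⟩
      exact ⟨c, Finset.mem_inter.2 ⟨Finset.mem_filter.2 ⟨Finset.mem_powerset.1 hS hc, hv⟩, hc⟩⟩
    · rintro ⟨c, hc⟩
      obtain ⟨h1, h2⟩ := Finset.mem_inter.1 hc
      exact ⟨c, h2, (Finset.mem_filter.1 h1).2⟩
  · gcongr
    rw [show (∑ j ∈ J, w j * (z ^ (a j).card - 1)) = _ from
      hsum fun x l => z ^ (visited A F x l).card - 1, mul_assoc]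
    refine mul_le_mul_of_nonneg_left ?_ hu
    have : ∀ x ∈ X, e x * meanN n (fun l => z ^ (visited A F x l).card - 1) ≤ 2 * z := by
      intro x hx
      obtain ⟨c, hc, hxc⟩ := Finset.mem_biUnion.1 hx
      rw [meanN_sub n _ fun _ => 1, meanN_const hd]
      have h1 := h.meanN_pow_le_of_mem hd hz hε n hc hxc
      have h2 : 1 ≤ meanN n fun l => z ^ (visited A F x l).card :=
        (meanN_const hd n 1).symm.trans_le (meanN_mono n fun l => one_le_pow₀ hz)
      obtain ⟨h3, h4⟩ := he0 x hx
      nlinarith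
    refine (Finset.sum_le_sum this).trans (le_of_eq ?_)
    simp [mul_comm]

/-! ### Hierarchical families of squares in the plane -/

/-- The `ℓ^∞`-distance on `ℤ²`. -/
noncomputable def supDist (p q : ℤ × ℤ) : ℤ := max |p.1 - q.1| |p.2 - q.2|

lemma supDist_comm (p q : ℤ × ℤ) : supDist p q = supDist q p := by
  simp [supDist, abs_sub_comm]

lemma supDist_triangle (p q r : ℤ × ℤ) : supDist p r ≤ supDist p q + supDist q r :=
  max_le ((abs_sub_le p.1 q.1 r.1).trans (add_le_add (le_max_left _ _) (le_max_left _ _)))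
    ((abs_sub_le p.2 q.2 r.2).trans (add_le_add (le_max_right _ _) (le_max_right _ _)))

lemma exists_eq_of_le {f : ℕ → ℤ} {N : ℕ} (hf : ∀ k < N, |f (k + 1) - f k| ≤ 1) {m : ℤ} {i j : ℕ}
    (hij : i ≤ j) (hj : j ≤ N) (hi : f i ≤ m) (hm : m ≤ f j) : ∃ k ≤ N, f k = m := by
  induction j, hij using Nat.le_induction with
  | base => exact ⟨i, hj, le_antisymm hi hm⟩
  | succ j _ ih =>
    rcases le_or_gt m (f j) with h | h
    · exact ih (by omega) h
    · have := (abs_le.1 (hf j (by omega))).2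
      exact ⟨j + 1, hj, by omega⟩

lemma exists_eq_of_abs_sub_le_one {f : ℕ → ℤ} {N : ℕ} (hf : ∀ k < N, |f (k + 1) - f k| ≤ 1)
    {m : ℤ} {i j : ℕ} (hiN : i ≤ N) (hjN : j ≤ N) (hi : f i ≤ m) (hm : m ≤ f j) :
    ∃ k ≤ N, f k = m := by
  rcases le_total i j with h | h
  · exact exists_eq_of_le hf h hjN hi hm
  · obtain ⟨k, hk, h⟩ := exists_eq_of_le (f := fun k => -f k) (m := -m)
      (fun k hk => by rw [neg_sub_neg, abs_sub_comm]; exact hf k hk) h hiN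
      (neg_le_neg hm) (neg_le_neg hi)
    exact ⟨k, hk, neg_injective h⟩

/-- The boundary of the square of radius `L` centred at `c`. -/
noncomputable def frame (L : ℕ) (c : ℤ × ℤ) : Finset (ℤ × ℤ) :=
  (Finset.Icc (c.1 - L) (c.1 + L) ×ˢ {c.2 - L, c.2 + (L : ℤ)}) ∪
    ({c.1 - L, c.1 + (L : ℤ)} ×ˢ Finset.Icc (c.2 - L) (c.2 + L))

lemma mem_frame {L : ℕ} {c q : ℤ × ℤ} : q ∈ frame L c ↔ supDist q c = L := by
  obtain ⟨q1, q2⟩ := q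
  obtain ⟨c1, c2⟩ := c
  simp only [frame, supDist, Finset.mem_union, Finset.mem_product, Finset.mem_Icc,
    Finset.mem_insert, Finset.mem_singleton]
  rcases abs_cases (q1 - c1) with h | h <;> rcases abs_cases (q2 - c2) with h' | h' <;> omega

lemma card_frame_le {L : ℕ} (hL : 1 ≤ L) (c : ℤ × ℤ) : (frame L c).card ≤ 12 * L := by
  refine (Finset.card_union_le _ _).trans ?_
  simp only [Finset.card_product, Int.card_Icc]
  have h1 := Finset.card_le_two (a := c.2 - L) (b := c.2 + (L : ℤ))
  have h2 := Finset.card_le_two (a := c.1 - L) (b := c.1 + (L : ℤ))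
  have h3 : (c.1 + L + 1 - (c.1 - L)).toNat = 2 * L + 1 := by omega
  have h4 : (c.2 + L + 1 - (c.2 - L)).toNat = 2 * L + 1 := by omega
  rw [h3, h4]
  nlinarith

/-- Pairs of points of the square of radius `M` at distance at least `m`. -/
@[irreducible]
noncomputable def farPairs (M m : ℤ) : Finset ((ℤ × ℤ) × (ℤ × ℤ)) :=
  ((Finset.Icc (-M) M ×ˢ Finset.Icc (-M) M) ×ˢ
    (Finset.Icc (-M) M ×ˢ Finset.Icc (-M) M)).filter fun a => m ≤ supDist a.1 a.2

lemma mem_farPairs {M m : ℤ} {a : (ℤ × ℤ) × (ℤ × ℤ)} : a ∈ farPairs M m ↔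
    ((a.1.1 ∈ Finset.Icc (-M) M ∧ a.1.2 ∈ Finset.Icc (-M) M) ∧
      a.2.1 ∈ Finset.Icc (-M) M ∧ a.2.2 ∈ Finset.Icc (-M) M) ∧ m ≤ supDist a.1 a.2 := by
  simp only [farPairs, Finset.mem_filter, Finset.mem_product]

lemma card_farPairs_le (M m : ℤ) : (farPairs M m).card ≤ (M + 1 + M).toNat ^ 4 := by
  rw [farPairs]
  refine (Finset.card_filter_le _ _).trans (le_of_eq ?_)
  simp only [Finset.card_product, Int.card_Icc, sub_neg_eq_add]
  ring

/-- Pairs of offsets of the two children of a vertex. -/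
noncomputable abbrev offsets : Finset ((ℤ × ℤ) × (ℤ × ℤ)) := farPairs 80 39

/-- An upper bound for the number of pairs of offsets. -/
def offsetBound : ℕ := 161 ^ 4

lemma card_offsets_le : offsets.card ≤ offsetBound := card_farPairs_le 80 39

/-- The centre of the child of `x` with offset `a` at scale `S`. -/
def child (S : ℤ) (x a : ℤ × ℤ) : ℤ × ℤ := (x.1 + S * a.1, x.2 + S * a.2)

/-- The hierarchical families of centres of squares of radius `L` below the vertex `x` at
height `k`. -/
noncomputable def conf (L : ℕ) : ℕ → ℤ × ℤ → Finset (Finset (ℤ × ℤ))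
  | 0, x => {{x}}
  | k + 1, x => offsets.biUnion fun a =>
      Finset.image₂ (· ∪ ·) (conf L k (child (40 ^ k * L) x a.1))
        (conf L k (child (40 ^ k * L) x a.2))

lemma card_conf_mul_le (L k : ℕ) (x : ℤ × ℤ) :
    (conf L k x).card * offsetBound ≤ offsetBound ^ 2 ^ k := by
  induction k generalizing x with
  | zero => simp [conf]
  | succ k ih =>
    rw [conf]
    have h : ∀ a ∈ offsets, (Finset.image₂ (· ∪ ·) (conf L k (child (40 ^ k * L) x a.1))
        (conf L k (child (40 ^ k * L) x a.2))).card * (offsetBound * offsetBound)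
          ≤ offsetBound ^ 2 ^ (k + 1) := by
      intro a _
      calc _ ≤ (conf L k (child (40 ^ k * L) x a.1)).card *
            (conf L k (child (40 ^ k * L) x a.2)).card * (offsetBound * offsetBound) := by
            gcongr
            exact Finset.card_image₂_le _ _ _
        _ = ((conf L k (child (40 ^ k * L) x a.1)).card * offsetBound) *
            ((conf L k (child (40 ^ k * L) x a.2)).card * offsetBound) := by ring
        _ ≤ offsetBound ^ 2 ^ k * offsetBound ^ 2 ^ k := Nat.mul_le_mul (ih _) (ih _)
        _ = offsetBound ^ 2 ^ (k + 1) := by rw [← pow_add, pow_succ, mul_two]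
    have hpos : 0 < offsetBound := by simp [offsetBound]
    refine Nat.le_of_mul_le_mul_right ?_ hpos
    calc _ ≤ (∑ a ∈ offsets, (Finset.image₂ (· ∪ ·) (conf L k (child (40 ^ k * L) x a.1))
            (conf L k (child (40 ^ k * L) x a.2))).card) * (offsetBound * offsetBound) := by
          rw [mul_assoc]
          exact Nat.mul_le_mul_right _ Finset.card_biUnion_le
      _ ≤ offsets.card * offsetBound ^ 2 ^ (k + 1) := by
          rw [Finset.sum_mul]
          exact (Finset.sum_le_sum h).trans (by simp)
      _ ≤ offsetBound ^ 2 ^ (k + 1) * offsetBound := by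
          rw [mul_comm]
          exact Nat.mul_le_mul_left _ card_offsets_le

lemma exists_offset {S M p x : ℤ} (hS : 0 < S) (h : |p - x| ≤ M * S) :
    ∃ a, a ∈ Finset.Icc (-M) M ∧ 0 ≤ p - (x + S * a) ∧ p - (x + S * a) < S := by
  have h1 := Int.mul_ediv_self_le (x := p - x) hS.ne'
  have h2 := Int.lt_mul_ediv_self_add (x := p - x) hS
  obtain ⟨h3, h4⟩ := abs_le.1 h
  refine ⟨(p - x) / S, Finset.mem_Icc.2 ⟨?_, ?_⟩, by linarith, by linarith⟩
  · by_contra! hc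
    nlinarith
  · by_contra! hc
    nlinarith

lemma exists_offset_pair {S : ℤ} (hS : 0 < S) {x p q : ℤ × ℤ} (hp : supDist p x = 40 * S)
    (hq : supDist q x = 80 * S) :
    ∃ a ∈ offsets, supDist p (child S x a.1) ≤ S ∧ supDist q (child S x a.2) ≤ S := by
  have hp1 : |p.1 - x.1| ≤ 80 * S := (le_max_left _ _).trans (hp.le.trans (by linarith))
  have hp2 : |p.2 - x.2| ≤ 80 * S := (le_max_right _ _).trans (hp.le.trans (by linarith))
  obtain ⟨a1, ha1, ha1', ha1''⟩ := exists_offset hS hp1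
  obtain ⟨a2, ha2, ha2', ha2''⟩ := exists_offset hS hp2
  obtain ⟨b1, hb1, hb1', hb1''⟩ := exists_offset hS ((le_max_left _ _).trans hq.le)
  obtain ⟨b2, hb2, hb2', hb2''⟩ := exists_offset hS ((le_max_right _ _).trans hq.le)
  refine ⟨((a1, a2), (b1, b2)), ?_, max_le ?_ ?_, max_le ?_ ?_⟩
  · refine mem_farPairs.2 ⟨⟨⟨ha1, ha2⟩, hb1, hb2⟩, ?_⟩
    have h1 := supDist_triangle q p x
    rw [hp, hq] at h1
    have key : ∀ {s t x a b : ℤ}, 0 ≤ s - (x + S * a) → s - (x + S * a) < S →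
        0 ≤ t - (x + S * b) → t - (x + S * b) < S → 40 * S ≤ |t - s| → 39 ≤ |a - b| := by
      intro s t x a b h1 h2 h3 h4 h5
      rcases le_abs.1 h5 with h | h
      · exact le_abs.2 (Or.inr (by by_contra! hc; nlinarith))
      · exact le_abs.2 (Or.inl (by by_contra! hc; nlinarith))
    rcases le_max_iff.1 (show 40 * S ≤ supDist q p by linarith) with h | h
    · exact le_max_of_le_left (key ha1' ha1'' hb1' hb1'' h)
    · exact le_max_of_le_right (key ha2' ha2'' hb2' hb2'' h)
  all_goals
    simp only [child]
    rw [abs_of_nonneg (by assumption)]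
    linarith

/-- A `*`-path crossing an annulus meets all squares of one of its hierarchical families. -/
lemma exists_conf_of_crossing {L : ℕ} (hL : 1 ≤ L) {w : ℕ → ℤ × ℤ} {N : ℕ}
    (hw : ∀ t < N, supDist (w t) (w (t + 1)) ≤ 1) (k : ℕ) (x : ℤ × ℤ) {i j : ℕ} (hi : i ≤ N)
    (hj : j ≤ N) (hix : supDist (w i) x ≤ 40 ^ k * L) (hjx : 2 * (40 ^ k * L) < supDist (w j) x) :
    ∃ A ∈ conf L k x, ∀ c ∈ A, ∃ t ≤ N, w t ∈ frame L c := by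
  have hivt : ∀ (x : ℤ × ℤ) {m : ℤ} {i j : ℕ}, i ≤ N → j ≤ N → supDist (w i) x ≤ m →
      m ≤ supDist (w j) x → ∃ t ≤ N, supDist (w t) x = m := by
    intro x m i j hi hj h1 h2
    refine exists_eq_of_abs_sub_le_one (fun t ht => abs_le.2 ?_) hi hj h1 h2
    have h3 := supDist_triangle (w t) (w (t + 1)) x
    have h4 := supDist_triangle (w (t + 1)) (w t) x
    rw [supDist_comm (w (t + 1)) (w t)] at h4
    have h5 := hw t ht
    constructor <;> linarith
  induction k generalizing x i j with
  | zero =>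
    obtain ⟨t, ht, h⟩ := hivt x (m := L) hi hj (by simpa using hix) (by simp at hjx; linarith)
    exact ⟨{x}, by simp [conf], fun c hc => ⟨t, ht, by
      rw [Finset.mem_singleton.1 hc]; exact mem_frame.2 h⟩⟩
  | succ k ih =>
    set S : ℤ := 40 ^ k * L with hS
    have hS0 : 0 < S := by positivity
    have hS' : (40 : ℤ) ^ (k + 1) * L = 40 * S := by rw [hS]; ring
    rw [hS'] at hix hjx
    obtain ⟨s, hs, hsx⟩ := hivt x (m := 40 * S) hi hj hix (by linarith)
    obtain ⟨t, ht, htx⟩ := hivt x (m := 80 * S) hi hj (by linarith) (by linarith)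
    obtain ⟨a, ha, ha1, ha2⟩ := exists_offset_pair hS0 hsx htx
    have h0 := supDist_triangle (w t) (w s) x
    have h1 := supDist_triangle (w t) (child S x a.1) (w s)
    have h2 := supDist_triangle (w t) (child S x a.2) (w s)
    rw [supDist_comm (child S x _) (w s)] at h1 h2
    obtain ⟨A, hA, hA'⟩ := ih (child S x a.1) hs ht ha1 (by linarith)
    obtain ⟨B, hB, hB'⟩ := ih (child S x a.2) ht hs ha2 (by linarith)
    refine ⟨A ∪ B, ?_, fun c hc => ?_⟩
    · rw [conf]
      exact Finset.mem_biUnion.2 ⟨a, ha, Finset.mem_image₂_of_mem hA hB⟩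
    · rcases Finset.mem_union.1 hc with h | h
      exacts [hA' c h, hB' c h]

lemma supDist_le_of_mem_conf {L k : ℕ} {x : ℤ × ℤ} {A : Finset (ℤ × ℤ)} (hA : A ∈ conf L k x)
    {c : ℤ × ℤ} (hc : c ∈ A) : supDist c x ≤ 3 * (40 ^ k * L) := by
  induction k generalizing x A with
  | zero =>
    rw [conf, Finset.mem_singleton] at hA
    subst hA
    rw [Finset.mem_singleton.1 hc]
    simp [supDist]
  | succ k ih =>
    rw [conf, Finset.mem_biUnion] at hA
    obtain ⟨a, ha, hA⟩ := hA
    obtain ⟨A₁, h₁, A₂, h₂, rfl⟩ := Finset.mem_image₂.1 hA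
    set S : ℤ := 40 ^ k * L with hS
    have hS0 : 0 ≤ S := by positivity
    have hS' : (40 : ℤ) ^ (k + 1) * L = 40 * S := by rw [hS]; ring
    have hchild : ∀ b : ℤ × ℤ, b.1 ∈ Finset.Icc (-80) 80 ∧ b.2 ∈ Finset.Icc (-80) 80 →
        supDist (child S x b) x ≤ 80 * S := by
      rintro b ⟨hb1, hb2⟩
      rw [Finset.mem_Icc] at hb1 hb2
      simp only [supDist, child, add_sub_cancel_left]
      refine max_le (abs_le.2 ⟨?_, ?_⟩) (abs_le.2 ⟨?_, ?_⟩) <;> nlinarith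
    obtain ⟨⟨ha1, ha2⟩, -⟩ := mem_farPairs.1 ha
    rw [hS']
    rcases Finset.mem_union.1 hc with h | h
    · have := supDist_triangle c (child S x a.1) x
      linarith [hchild _ ha1, ih h₁ h]
    · have := supDist_triangle c (child S x a.2) x
      linarith [hchild _ ha2, ih h₂ h]

lemma le_supDist_child {S : ℤ} (hS : 0 ≤ S) (x : ℤ × ℤ) {a : (ℤ × ℤ) × (ℤ × ℤ)}
    (ha : a ∈ offsets) : 39 * S ≤ supDist (child S x a.1) (child S x a.2) := by
  have h := (mem_farPairs.1 ha).2
  simp only [supDist, child, add_sub_add_left_eq_sub, ← mul_sub, abs_mul, abs_of_nonneg hS]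
  rw [← mul_max_of_nonneg _ _ hS]
  rw [supDist] at h
  nlinarith

/-- Squares below different children are far apart. -/
lemma le_supDist_of_mem_frame {L k : ℕ} {x : ℤ × ℤ} {a : (ℤ × ℤ) × (ℤ × ℤ)} (ha : a ∈ offsets)
    {A₁ A₂ : Finset (ℤ × ℤ)} (h₁ : A₁ ∈ conf L k (child (40 ^ k * L) x a.1))
    (h₂ : A₂ ∈ conf L k (child (40 ^ k * L) x a.2)) {c₁ c₂ q₁ q₂ : ℤ × ℤ} (hc₁ : c₁ ∈ A₁)
    (hc₂ : c₂ ∈ A₂) (hq₁ : supDist q₁ c₁ ≤ L) (hq₂ : supDist q₂ c₂ ≤ L) :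
    31 * (40 ^ k * L) ≤ supDist q₁ q₂ := by
  have e1 := supDist_le_of_mem_conf h₁ hc₁
  have e2 := supDist_le_of_mem_conf h₂ hc₂
  have e3 := le_supDist_child (S := 40 ^ k * L) (by positivity) x ha
  have hk : (L : ℤ) ≤ 40 ^ k * L :=
    le_mul_of_one_le_left (by positivity) (one_le_pow₀ (by norm_num))
  set S : ℤ := 40 ^ k * L
  have t1 := supDist_triangle (child S x a.1) c₁ (child S x a.2)
  have t2 := supDist_triangle c₁ q₁ (child S x a.2)
  have t3 := supDist_triangle q₁ q₂ (child S x a.2)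
  have t4 := supDist_triangle q₂ c₂ (child S x a.2)
  rw [supDist_comm c₁ q₁] at t2
  rw [supDist_comm _ c₁] at t1
  linarith

lemma card_of_mem_conf {L : ℕ} (hL : 1 ≤ L) {k : ℕ} {x : ℤ × ℤ} {A : Finset (ℤ × ℤ)}
    (hA : A ∈ conf L k x) : A.card = 2 ^ k := by
  induction k generalizing x A with
  | zero =>
    rw [conf, Finset.mem_singleton] at hA
    simp [hA]
  | succ k ih =>
    rw [conf, Finset.mem_biUnion] at hA
    obtain ⟨a, ha, hA⟩ := hA
    obtain ⟨A₁, h₁, A₂, h₂, rfl⟩ := Finset.mem_image₂.1 hA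
    have hS0 : (0 : ℤ) < 40 ^ k * L := by positivity
    rw [Finset.card_union_of_disjoint, ih h₁, ih h₂, pow_succ, mul_two]
    refine Finset.disjoint_left.2 fun c hc₁ hc₂ => ?_
    have h0 : supDist c c = 0 := by simp [supDist]
    have := le_supDist_of_mem_frame ha h₁ h₂ (q₁ := c) (q₂ := c) hc₁ hc₂ (by simp [h0])
      (by simp [h0])
    rw [h0] at this
    linarith

/-! ### Potentials of planar squares -/

/-- The embedding of `ℤ²` as a coordinate plane. -/
def emb {d : ℕ} (q : ℤ × ℤ) : Zd d :=
  fun i => if i.val = 0 then q.1 else if i.val = 1 then q.2 else 0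

/-- The boundary of a square, as a subset of `ℤ^d`. -/
noncomputable def square {d : ℕ} (L : ℕ) (c : ℤ × ℤ) : Finset (Zd d) := (frame L c).image emb

lemma card_square_le {d L : ℕ} (hL : 1 ≤ L) (c : ℤ × ℤ) :
    (square L c : Finset (Zd d)).card ≤ 12 * L :=
  Finset.card_image_le.trans (card_frame_le hL c)

/-- The potential of the boundary of a square. -/
noncomputable def squarePot {d : ℕ} (L : ℕ) (c : ℤ × ℤ) (x : Zd d) : ℝ :=
  ∑ q ∈ frame L c, pot (x - emb q)

lemma squarePot_nonneg {d : ℕ} (L : ℕ) (c : ℤ × ℤ) (x : Zd d) : 0 ≤ squarePot L c x :=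
  Finset.sum_nonneg fun _ _ => pot_nonneg _

lemma avg_squarePot_div_le {d : ℕ} (hd : 3 ≤ d) (L : ℕ) (c : ℤ × ℤ) {b : ℝ} (hb : 0 ≤ b)
    (x : Zd d) : avg (fun y => squarePot L c y / b) x ≤ squarePot L c x / b := by
  have : avg (fun y => squarePot L c y / b) x
      = (∑ q ∈ frame L c, avg pot (x - emb q)) / b := by
    simp only [avg, squarePot, ← Finset.sum_div, add_sub_right_comm]
    rw [Finset.sum_comm, div_right_comm]
  rw [this]
  unfold squarePot
  gcongr
  exact avg_pot_le hd _

lemma pot_emb_sub_emb {d : ℕ} (hd : 2 ≤ d) (p q : ℤ × ℤ) :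
    pot (emb p - emb q : Zd d)
      = 1 / √(((p.1 - q.1 : ℤ) : ℝ) ^ 2 + ((p.2 - q.2 : ℤ) : ℝ) ^ 2 + 10) := by
  have h : ∀ i : Fin d, (((emb p - emb q : Zd d) i : ℤ) : ℝ) ^ 2
      = (if i = ⟨0, by omega⟩ then ((p.1 - q.1 : ℤ) : ℝ) ^ 2 else 0)
        + if i = ⟨1, by omega⟩ then ((p.2 - q.2 : ℤ) : ℝ) ^ 2 else 0 := by
    intro i
    simp only [emb, Pi.sub_apply, Fin.ext_iff]
    by_cases h0 : i.val = 0
    · simp [h0]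
    · by_cases h1 : i.val = 1 <;> simp [h0, h1]
  rw [pot, Finset.sum_congr rfl fun i _ => h i, Finset.sum_add_distrib]
  simp

lemma pot_emb_sub_emb_le {d : ℕ} (hd : 2 ≤ d) {p q : ℤ × ℤ} {D : ℝ} (hD : 0 < D)
    (h : D ≤ supDist p q) : pot (emb p - emb q : Zd d) ≤ 1 / D := by
  rcases max_cases |p.1 - q.1| |p.2 - q.2| with ⟨h', -⟩ | ⟨h', -⟩ <;>
    rw [supDist, h', Int.cast_abs] at h
  · exact pot_le _ ⟨0, by omega⟩ hD (by simpa [emb] using h)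
  · exact pot_le _ ⟨1, by omega⟩ hD (by simpa [emb] using h)

lemma one_div_le_one_div_sqrt (j : ℕ) :
    1 / 4 * (1 / ((j : ℝ) + 1)) ≤ 1 / √((j : ℝ) ^ 2 + 10) := by
  have hj : (0 : ℝ) ≤ j := Nat.cast_nonneg j
  rw [one_div_mul_one_div]
  refine one_div_le_one_div_of_le (by positivity) (Real.sqrt_le_iff.2 ⟨by positivity, ?_⟩)
  nlinarith

lemma sum_le_of_injOn {L : ℕ} {s : Finset (ℤ × ℤ)} {f : ℤ × ℤ → ℝ} (hf : ∀ q, 0 ≤ f q)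
    (φ : ℕ → ℤ × ℤ) (hφ : Function.Injective φ) (hs : ∀ j < L, φ j ∈ s)
    (h : ∀ j < L, 1 / 4 * (1 / ((j : ℝ) + 1)) ≤ f (φ j)) :
    1 / 4 * ∑ j ∈ Finset.range L, 1 / ((j : ℝ) + 1) ≤ ∑ q ∈ s, f q := by
  rw [Finset.mul_sum]
  calc _ ≤ ∑ j ∈ Finset.range L, f (φ j) :=
        Finset.sum_le_sum fun j hj => h j (Finset.mem_range.1 hj)
    _ = ∑ q ∈ (Finset.range L).image φ, f q := (Finset.sum_image hφ.injOn).symm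
    _ ≤ _ := Finset.sum_le_sum_of_subset_of_nonneg
        (Finset.image_subset_iff.2 fun j hj => hs j (Finset.mem_range.1 hj)) fun q _ _ => hf q

lemma le_squarePot {d : ℕ} (hd : 2 ≤ d) {L : ℕ} {c : ℤ × ℤ} {x : Zd d} (hx : x ∈ square L c) :
    1 / 4 * ∑ j ∈ Finset.range L, 1 / ((j : ℝ) + 1) ≤ squarePot L c x := by
  obtain ⟨p, hp, rfl⟩ := Finset.mem_image.1 hx
  have hL := mem_frame.1 hp
  rcases max_cases |p.1 - c.1| |p.2 - c.2| with ⟨h', h2⟩ | ⟨h', h2⟩ <;>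
    rw [supDist, h'] at hL
  · set s : ℤ := if p.2 ≤ c.2 then 1 else -1 with hs
    have hs1 : s = 1 ∧ p.2 ≤ c.2 ∨ s = -1 ∧ c.2 < p.2 := by
      by_cases h : p.2 ≤ c.2
      · simp [hs, h]
      · simp [hs, h, not_le.1 h]
    refine sum_le_of_injOn (fun q => pot_nonneg _) (fun j => (p.1, p.2 + s * j)) ?_ ?_ ?_
    · intro i j hij
      simp only [Prod.mk.injEq, true_and] at hij
      rcases hs1 with ⟨h, -⟩ | ⟨h, -⟩ <;> rw [h] at hij <;> omega
    · intro j hj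
      rw [mem_frame, supDist, hL]
      rw [hL] at h2
      refine max_eq_left (abs_le.2 ?_)
      have h3 := abs_le.1 h2
      rcases hs1 with ⟨h, -⟩ | ⟨h, -⟩ <;> rw [h] <;> constructor <;> dsimp only <;> omega
    · intro j _
      rw [pot_emb_sub_emb hd]
      refine (one_div_le_one_div_sqrt j).trans (le_of_eq ?_)
      rcases hs1 with ⟨h, -⟩ | ⟨h, -⟩ <;> simp [h]
  · set s : ℤ := if p.1 ≤ c.1 then 1 else -1 with hs
    have hs1 : s = 1 ∧ p.1 ≤ c.1 ∨ s = -1 ∧ c.1 < p.1 := by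
      by_cases h : p.1 ≤ c.1
      · simp [hs, h]
      · simp [hs, h, not_le.1 h]
    refine sum_le_of_injOn (fun q => pot_nonneg _) (fun j => (p.1 + s * j, p.2)) ?_ ?_ ?_
    · intro i j hij
      simp only [Prod.mk.injEq, and_true] at hij
      rcases hs1 with ⟨h, -⟩ | ⟨h, -⟩ <;> rw [h] at hij <;> omega
    · intro j hj
      rw [mem_frame, supDist, hL]
      rw [hL] at h2
      refine max_eq_right (abs_le.2 ?_)
      have h3 := abs_le.1 h2.le
      rcases hs1 with ⟨h, -⟩ | ⟨h, -⟩ <;> rw [h] <;> constructor <;> dsimp only <;> omega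
    · intro j _
      rw [pot_emb_sub_emb hd]
      refine (one_div_le_one_div_sqrt j).trans (le_of_eq ?_)
      rcases hs1 with ⟨h, -⟩ | ⟨h, -⟩ <;> simp [h]

/-- The potential of a far away square is small. -/
lemma squarePot_le {d : ℕ} (hd : 2 ≤ d) {L : ℕ} (hL : 1 ≤ L) (k : ℕ) {c p : ℤ × ℤ}
    (h : ∀ q, supDist q c ≤ L → 31 * (40 ^ k * L) ≤ supDist p q) :
    squarePot L c (emb p : Zd d) ≤ (1 / 40) ^ k := by
  have hL0 : (0 : ℝ) < L := by exact_mod_cast hL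
  have h1 : ∀ q ∈ frame L c, pot (emb p - emb q : Zd d) ≤ 1 / (31 * (40 ^ k * L)) := by
    intro q hq
    refine pot_emb_sub_emb_le hd (by positivity) ?_
    exact_mod_cast h q (mem_frame.1 hq).le
  refine (Finset.sum_le_card_nsmul _ _ _ h1).trans ?_
  have h2 : ((frame L c).card : ℝ) ≤ 12 * L := by exact_mod_cast card_frame_le hL c
  rw [nsmul_eq_mul, one_div_pow, mul_one_div, div_le_div_iff₀ (by positivity) (by positivity)]
  have h3 : (0 : ℝ) < 40 ^ k := by positivity
  nlinarith [mul_pos h3 hL0]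

lemma sum_squarePot_le {d : ℕ} (hd : 2 ≤ d) {L : ℕ} (hL : 1 ≤ L) {k : ℕ} {x : ℤ × ℤ}
    {A : Finset (ℤ × ℤ)} (hA : A ∈ conf L k x) {c : ℤ × ℤ} (hc : c ∈ A) {y : Zd d}
    (hy : y ∈ square L c) :
    ∑ c' ∈ A.erase c, squarePot L c' y ≤ 2 * (1 - (1 / 20) ^ k) := by
  obtain ⟨p, hp, rfl⟩ := Finset.mem_image.1 hy
  have hpc := (mem_frame.1 hp).le
  clear hy hp
  induction k generalizing x A with
  | zero =>
    rw [conf, Finset.mem_singleton] at hA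
    subst hA
    simp [Finset.mem_singleton.1 hc]
  | succ k ih =>
    rw [conf, Finset.mem_biUnion] at hA
    obtain ⟨a, ha, hA⟩ := hA
    obtain ⟨A₁, h₁, A₂, h₂, rfl⟩ := Finset.mem_image₂.1 hA
    have split : ∀ {B C : Finset (ℤ × ℤ)}, C.card = 2 ^ k →
        ∑ c' ∈ B.erase c, squarePot L c' (emb p : Zd d) ≤ 2 * (1 - (1 / 20) ^ k) →
        (∀ c' ∈ C, ∀ q, supDist q c' ≤ L → 31 * (40 ^ k * L) ≤ supDist p q) →
        ∑ c' ∈ (B ∪ C).erase c, squarePot L c' (emb p : Zd d)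
          ≤ 2 * (1 - (1 / 20) ^ (k + 1)) := by
      intro B C hC hB hBC
      calc _ ≤ ∑ c' ∈ B.erase c ∪ C, squarePot L c' (emb p : Zd d) := by
            refine Finset.sum_le_sum_of_subset_of_nonneg ?_ fun _ _ _ => squarePot_nonneg _ _ _
            rw [Finset.erase_union_distrib]
            exact Finset.union_subset_union_right (Finset.erase_subset _ _)
        _ ≤ ∑ c' ∈ B.erase c, squarePot L c' (emb p : Zd d)
            + ∑ c' ∈ C, squarePot L c' (emb p : Zd d) := by
            rw [← Finset.sum_union_inter]
            exact le_add_of_nonneg_right (Finset.sum_nonneg fun _ _ => squarePot_nonneg _ _ _)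
        _ ≤ 2 * (1 - (1 / 20) ^ k) + C.card • ((1 : ℝ) / 40) ^ k :=
            add_le_add hB (Finset.sum_le_card_nsmul _ _ _ fun c' hc' =>
              squarePot_le hd hL k (hBC c' hc'))
        _ ≤ 2 * (1 - (1 / 20) ^ (k + 1)) := by
            have h3 : (2 : ℝ) ^ k * (1 / 40) ^ k = (1 / 20) ^ k := by
              rw [← mul_pow]; norm_num
            rw [hC, nsmul_eq_mul]
            push_cast
            rw [h3, pow_succ]
            have : (0 : ℝ) < (1 / 20) ^ k := by positivity
            linarith
    rcases Finset.mem_union.1 hc with h | h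
    · exact split (card_of_mem_conf hL h₂) (ih h₁ h) fun c' hc' q hq =>
        le_supDist_of_mem_frame ha h₁ h₂ h hc' hpc hq
    · rw [Finset.union_comm]
      refine split (card_of_mem_conf hL h₁) (ih h₂ h) fun c' hc' q hq => ?_
      rw [supDist_comm]
      exact le_supDist_of_mem_frame ha h₁ h₂ hc' h hq hpc

lemma separated_of_mem_conf {d : ℕ} (hd : 3 ≤ d) {L : ℕ} (hL : 1 ≤ L) {z : ℝ} (hz : 0 < z)
    (hLz : 8 * z ≤ 1 / 4 * ∑ j ∈ Finset.range L, 1 / ((j : ℝ) + 1)) {k : ℕ} {x : ℤ × ℤ}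
    {A : Finset (ℤ × ℤ)} (hA : A ∈ conf L k x) :
    Separated A (square L : ℤ × ℤ → Finset (Zd d)) (fun c x => squarePot L c x / (8 * z))
      (2 / (8 * z)) where
  nonneg c x := div_nonneg (squarePot_nonneg _ _ _) (by positivity)
  superharmonic c x := avg_squarePot_div_le hd L c (by positivity) x
  one_le c x hx := (one_le_div (by positivity)).2 (hLz.trans (le_squarePot (by omega) hx))
  sum_le c hc x hx := by
    rw [← Finset.sum_div]
    have := sum_squarePot_le (by omega) hL hA hc hx
    have h2 : (0 : ℝ) < (1 / 20) ^ k := by positivity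
    gcongr
    linarith

/-! ### Conclusion -/

lemma conf_card_le (L k : ℕ) (x : ℤ × ℤ) : (conf L k x).card ≤ offsetBound ^ 2 ^ k :=
  (Nat.le_mul_of_pos_right _ (by norm_num [offsetBound])).trans (card_conf_mul_le L k x)

/-- A planar `*`-path from the origin to distance `R` meets all squares of a hierarchical family. -/
lemma exists_conf_of_hasStarPath {d : ℕ} (hd : 2 ≤ d) {L : ℕ} (hL : 1 ≤ L) {n R : ℕ}
    (hR : 2 * (40 ^ n * L) < R) {Y : Zd d → Bool}
    (h : HasStarPath {(0 : Zd d)} {x : Zd d | (∀ i, |x i| ≤ (R : ℤ)) ∧ ∃ i, |x i| = (R : ℤ)}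
      {x : Zd d | inPlane x ∧ Y x = false}) :
    ∃ A ∈ conf L n 0, ∀ c ∈ A, ∃ x ∈ (square L c : Finset (Zd d)), Y x = false := by
  obtain ⟨N, w, h0, ⟨-, i, hi⟩, hA, hadj⟩ := h
  rw [Set.mem_singleton_iff] at h0
  set w' : ℕ → ℤ × ℤ := fun t => (w t ⟨0, by omega⟩, w t ⟨1, by omega⟩) with hw'
  have hemb : ∀ t ≤ N, emb (w' t) = w t := by
    intro t ht
    funext i
    rw [emb]
    split_ifs with h1 h2
    · exact congrArg (w t) (Fin.ext h1.symm)
    · exact congrArg (w t) (Fin.ext h2.symm)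
    · exact ((hA t ht).1 i (by omega)).symm
  have hstep : ∀ t < N, supDist (w' t) (w' (t + 1)) ≤ 1 := fun t ht =>
    max_le ((hadj t ht).2 _) ((hadj t ht).2 _)
  have hend : (R : ℤ) ≤ supDist (w' N) 0 := by
    rw [← hi, ← hemb N le_rfl, emb]
    simp only [supDist, Prod.fst_zero, Prod.snd_zero, sub_zero]
    split_ifs
    · exact le_max_left _ _
    · exact le_max_right _ _
    · rw [abs_zero]; exact le_max_of_le_left (abs_nonneg _)
  obtain ⟨A, hAn, hA'⟩ := exists_conf_of_crossing hL hstep n 0 (Nat.zero_le N) le_rfl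
    (by simp [hw', h0, supDist]) (lt_of_lt_of_le (by exact_mod_cast hR) hend)
  refine ⟨A, hAn, fun c hc => ?_⟩
  obtain ⟨t, ht, htc⟩ := hA' c hc
  exact ⟨w t, Finset.mem_image.2 ⟨w' t, htc, hemb t ht⟩, (hA t ht).2⟩

/-- Doubly exponential decay of the connection probabilities along a geometric scale. -/
lemma starPath_toReal_le {d : ℕ} (hd : 3 ≤ d) {P : Zd d → Measure (ℕ → Zd d)} (hP : IsSRW d P)
    {L : ℕ} (hL : 1 ≤ L) {z : ℝ} (hz : z = 6 * offsetBound)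
    (hLz : 8 * z ≤ 1 / 4 * ∑ j ∈ Finset.range L, 1 / ((j : ℝ) + 1)) {u : ℝ} (hu : 0 ≤ u)
    (huz : u ≤ 1 / (2 * z * (12 * L))) {Q : Measure (Zd d → Bool)} (hQ : IsVacantLaw P u Q)
    {n R : ℕ} (hR : 2 * (40 ^ n * L) < R) :
    (Q {Y | HasStarPath {(0 : Zd d)}
      {x : Zd d | (∀ i, |x i| ≤ (R : ℤ)) ∧ ∃ i, |x i| = (R : ℤ)}
      {x : Zd d | inPlane x ∧ Y x = false}}).toReal ≤ (1 / 2) ^ 2 ^ n := by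
  have := hQ.1
  have hC : (1 : ℝ) ≤ offsetBound := by norm_num [offsetBound]
  have hz1 : 1 ≤ z := by linarith
  have hL0 : (0 : ℝ) < L := by exact_mod_cast hL
  have hA : ∀ A ∈ conf L n 0, Q.real {Y : Zd d → Bool | ∀ c ∈ A, ∃ x ∈ square L c, Y x = false}
      ≤ (z ^ 2 ^ n)⁻¹ * Real.exp 1 ^ 2 ^ n := by
    intro A hA
    have h1 := all_occupied_le (by omega) hP hu hQ
      (separated_of_mem_conf hd hL (by linarith) hLz hA) hz1 (by field_simp; norm_num)
    have hcard := card_of_mem_conf hL hA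
    rw [hcard] at h1
    refine h1.trans ?_
    rw [← Real.exp_nat_mul, mul_one]
    gcongr
    have h2 : ((A.biUnion (square L : ℤ × ℤ → Finset (Zd d))).card : ℝ) ≤ 2 ^ n * (12 * L) := by
      have := Finset.card_biUnion_le_card_mul A (square L : ℤ × ℤ → Finset (Zd d)) (12 * L)
        fun c _ => card_square_le hL c
      rw [hcard] at this
      exact_mod_cast this
    rw [le_div_iff₀ (by positivity)] at huz
    push_cast
    calc _ ≤ u * (2 * z) * (2 ^ n * (12 * L)) := by gcongr
      _ = (u * (2 * z * (12 * L))) * 2 ^ n := by ring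
      _ ≤ 1 * 2 ^ n := by gcongr
      _ = 2 ^ n := one_mul _
  have hsub : {Y : Zd d → Bool | HasStarPath {(0 : Zd d)}
      {x : Zd d | (∀ i, |x i| ≤ (R : ℤ)) ∧ ∃ i, |x i| = (R : ℤ)}
      {x : Zd d | inPlane x ∧ Y x = false}}
      ⊆ ⋃ A ∈ conf L n 0, {Y | ∀ c ∈ A, ∃ x ∈ square L c, Y x = false} := by
    intro Y hY
    obtain ⟨A, hA, h⟩ := exists_conf_of_hasStarPath (by omega) hL hR hY
    exact Set.mem_biUnion hA h
  calc _ ≤ Q.real (⋃ A ∈ conf L n 0, {Y | ∀ c ∈ A, ∃ x ∈ square L c, Y x = false}) :=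
        measureReal_mono hsub (measure_ne_top _ _)
    _ ≤ ∑ A ∈ conf L n 0, Q.real {Y | ∀ c ∈ A, ∃ x ∈ square L c, Y x = false} :=
        measureReal_biUnion_finset_le _ _
    _ ≤ (conf L n 0).card • ((z ^ 2 ^ n)⁻¹ * Real.exp 1 ^ 2 ^ n) :=
        Finset.sum_le_card_nsmul _ _ _ hA
    _ ≤ (offsetBound : ℝ) ^ 2 ^ n * ((z ^ 2 ^ n)⁻¹ * Real.exp 1 ^ 2 ^ n) := by
        rw [nsmul_eq_mul]
        gcongr
        exact_mod_cast conf_card_le L n 0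
    _ = (Real.exp 1 / 6) ^ 2 ^ n := by
        rw [← inv_pow, ← mul_pow, ← mul_pow, hz]
        congr 1
        field_simp
    _ ≤ (1 / 2) ^ 2 ^ n := by
        exact pow_le_pow_left₀ (by positivity) (by linarith [Real.exp_one_lt_d9]) _

lemma tendsto_rpow_mul_of_le {L : ℕ} (hL : 1 ≤ L) {g : ℕ → ℝ} (hg0 : ∀ R, 0 ≤ g R)
    (hg : ∀ n R, 2 * (40 ^ n * L) < R → g R ≤ (1 / 2) ^ 2 ^ n) {ρ : ℝ} (hρ : 0 < ρ) :
    Tendsto (fun R : ℕ => (R : ℝ) ^ ρ * g R) atTop (nhds 0) := by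
  obtain ⟨m, hm⟩ := pow_unbounded_of_one_lt ((40 : ℝ) ^ ρ) one_lt_two
  set K : ℝ := (3 * L * 40) ^ ρ
  have hN : Tendsto (fun R : ℕ => Nat.log 40 (R / (3 * L))) atTop atTop := by
    refine tendsto_atTop.2 fun b => ?_
    filter_upwards [eventually_ge_atTop (40 ^ b * (3 * L))] with R hR
    exact Nat.le_log_of_pow_le (by norm_num) ((Nat.le_div_iff_mul_le (by positivity)).2 hR)
  have hlim := (((tendsto_pow_const_div_const_pow_of_one_lt m (one_lt_two (α := ℝ))).comp
    (tendsto_pow_atTop_atTop_of_one_lt (one_lt_two (α := ℕ)))).comp hN).const_mul K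
  rw [mul_zero] at hlim
  refine squeeze_zero' (Eventually.of_forall fun R => mul_nonneg (by positivity) (hg0 R)) ?_ hlim
  filter_upwards [eventually_ge_atTop (3 * L)] with R hR
  simp only [Function.comp_apply]
  set n := Nat.log 40 (R / (3 * L)) with hn
  have hdiv : R / (3 * L) ≠ 0 := (Nat.div_pos hR (by positivity)).ne'
  have h1 : 40 ^ n * (3 * L) ≤ R :=
    (Nat.le_div_iff_mul_le (by positivity)).1 (Nat.pow_log_le_self 40 hdiv)
  have h2 : R < 40 ^ (n + 1) * (3 * L) :=
    (Nat.div_lt_iff_lt_mul (by positivity)).1 (Nat.lt_pow_succ_log_self (by norm_num) _)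
  have h3 : g R ≤ (1 / 2) ^ 2 ^ n := by
    refine hg n R ?_
    have : 0 < 40 ^ n * L := by positivity
    nlinarith
  have h4 : (R : ℝ) ^ ρ ≤ K * ((2 ^ n : ℕ) : ℝ) ^ m := by
    have h5 : (R : ℝ) ≤ (3 * L * 40) * 40 ^ n := by
      have : (R : ℝ) ≤ 40 ^ (n + 1) * (3 * L) := by exact_mod_cast h2.le
      rw [pow_succ] at this
      linarith
    calc (R : ℝ) ^ ρ ≤ ((3 * L * 40) * 40 ^ n) ^ ρ :=
          Real.rpow_le_rpow (by positivity) h5 hρ.le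
      _ = K * ((40 : ℝ) ^ ρ) ^ n := by
          rw [Real.mul_rpow (by positivity) (by positivity), ← Real.rpow_natCast_mul (by norm_num),
            ← Real.rpow_mul_natCast (by norm_num), mul_comm (n : ℝ)]
      _ ≤ K * ((2 : ℝ) ^ m) ^ n := by gcongr
      _ = K * ((2 ^ n : ℕ) : ℝ) ^ m := by push_cast; rw [← pow_mul, ← pow_mul, mul_comm m]
  calc (R : ℝ) ^ ρ * g R ≤ K * ((2 ^ n : ℕ) : ℝ) ^ m * (1 / 2) ^ 2 ^ n :=
        mul_le_mul h4 h3 (hg0 R) (by positivity)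
    _ = K * (((2 ^ n : ℕ) : ℝ) ^ m / 2 ^ 2 ^ n) := by rw [one_div_pow]; ring

end RI

/-- **Polynomial decay of planar `*`-connection probabilities at small levels** ((3.28)).
For every `ρ > 0` there is `u(ρ) > 0` such that for all `0 < u ≤ u(ρ)` and every
vacant-set law `Q` at level `u`:
`L^ρ Q[∃ *-path from 0 to S(0,L) inside {x ∈ ℤ² : Y_x = 0}] → 0` as `L → ∞`. -/
theorem star_connection_decay (d : ℕ) (hd : 3 ≤ d) (ρ : ℝ) (hρ : 0 < ρ) :
    ∃ uρ : ℝ, 0 < uρ ∧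
      ∀ u : ℝ, 0 < u → u ≤ uρ →
        ∀ (P : Zd d → Measure (ℕ → Zd d)), IsSRW d P →
          ∀ Q : Measure (Zd d → Bool), IsVacantLaw P u Q →
            Tendsto (fun L : ℕ =>
                (L : ℝ) ^ ρ * (Q {Y | HasStarPath
                  {(0 : Zd d)}
                  {x : Zd d | (∀ i, |x i| ≤ (L : ℤ)) ∧ ∃ i, |x i| = (L : ℤ)}
                  {x : Zd d | inPlane x ∧ Y x = false}}).toReal)
              atTop (nhds 0) := by
  set z : ℝ := 6 * offsetBound with hz
  have hz0 : 0 < z := by norm_num [hz, offsetBound]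
  obtain ⟨L, hLz, hL⟩ := (((Real.tendsto_sum_range_one_div_nat_succ_atTop.const_mul_atTop
    (by norm_num : (0 : ℝ) < 1 / 4)).eventually_ge_atTop (8 * z)).and
    (eventually_ge_atTop 1)).exists
  have hL0 : (0 : ℝ) < L := by exact_mod_cast hL
  refine ⟨1 / (2 * z * (12 * L)), by positivity, fun u hu huz P hP Q hQ => ?_⟩
  exact tendsto_rpow_mul_of_le hL (fun _ => ENNReal.toReal_nonneg)
    (fun n R hR => starPath_toReal_le hd hP hL hz hLz hu.le huz hQ hR) hρ
end

section
/- There exists a universal constant c > 0 such that for every integer r ≥ 2 and all reals λ*, λ' > 0 with λ* ≥ 4r·λ', if N* and N' are independent Poisson random variables with respective means λ* and λ', then P( N* < r·N' ) ≤ c·exp( −λ*/(c·r) ). -/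
open MeasureTheory ProbabilityTheory

/-- A natural-number valued variable with Poisson point probabilities has Poisson law. -/
lemma map_eq_poissonMeasure {Ω : Type*} [MeasurableSpace Ω] {P : Measure Ω}
    [IsFiniteMeasure P] {N : Ω → ℕ} (hN : Measurable N) {l : NNReal}
    (h : ∀ k : ℕ, (P {ω | N ω = k}).toReal = Real.exp (-l) * l ^ k / k.factorial) :
    P.map N = poissonMeasure l := by
  refine Measure.ext_of_singleton fun k => ?_
  rw [Measure.map_apply hN (measurableSet_singleton k), poissonMeasure_singleton,
    ← ENNReal.ofReal_toReal (measure_ne_top P _)]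
  congr 1
  exact h k

lemma hasSum_poisson_exp (l t : ℝ) :
    HasSum (fun k : ℕ => Real.exp (-l) * l ^ k / k.factorial * Real.exp (t * k))
      (Real.exp (l * (Real.exp t - 1))) := by
  convert! (NormedSpace.expSeries_div_hasSum_exp (l * Real.exp t)).mul_left
    (Real.exp (-l)) using 1
  · ext k
    rw [mul_pow, ← Real.exp_nat_mul, mul_comm t]
    ring
  · rw [← Real.exp_eq_exp_ℝ, ← Real.exp_add]
    ring_nf

lemma integrable_exp_mul_of_poisson {Ω : Type*} [MeasurableSpace Ω] {P : Measure Ω}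
    [IsFiniteMeasure P] {N : Ω → ℕ} (hN : Measurable N) {l : NNReal}
    (h : ∀ k : ℕ, (P {ω | N ω = k}).toReal = Real.exp (-l) * l ^ k / k.factorial) (t : ℝ) :
    Integrable (fun ω => Real.exp (t * N ω)) P := by
  have hi : Integrable (fun k : ℕ => Real.exp (t * k)) (P.map N) := by
    rw [map_eq_poissonMeasure hN h, integrable_poissonMeasure_iff]
    simpa using (hasSum_poisson_exp l t).summable
  exact hi.comp_measurable hN

lemma mgf_of_poisson {Ω : Type*} [MeasurableSpace Ω] {P : Measure Ω}
    [IsFiniteMeasure P] {N : Ω → ℕ} (hN : Measurable N) {l : NNReal}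
    (h : ∀ k : ℕ, (P {ω | N ω = k}).toReal = Real.exp (-l) * l ^ k / k.factorial) (t : ℝ) :
    mgf (fun ω => (N ω : ℝ)) P t = Real.exp (l * (Real.exp t - 1)) := by
  have hm : ∫ k, Real.exp (t * (k : ℕ)) ∂(P.map N) = mgf (fun ω => (N ω : ℝ)) P t :=
    integral_map hN.aemeasurable .of_discrete
  rw [← hm, map_eq_poissonMeasure hN h, integral_poissonMeasure]
  simpa using (hasSum_poisson_exp l t).tsum_eq

/-- The exponent of the Chernoff bound at parameter `1 / r`. -/
lemma chernoff_exponent_le {r lamS lam' : ℝ} (hr : 2 ≤ r) (hS : 0 < lamS)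
    (h : 4 * r * lam' ≤ lamS) :
    lamS * (Real.exp (-(1 / r)) - 1) + lam' * (Real.exp 1 - 1) ≤ -(lamS / (8 * r)) := by
  have hr0 : 0 < r := by linarith
  have hexp : Real.exp (-(1 / r)) - 1 ≤ -(2 / (3 * r)) := by
    have h1 : Real.exp (-(1 / r)) ≤ (1 / r + 1)⁻¹ := by
      rw [Real.exp_neg]
      exact inv_anti₀ (by positivity) (Real.add_one_le_exp _)
    have h2 : (1 / r + 1)⁻¹ - 1 ≤ -(2 / (3 * r)) := by
      rw [show (1 / r + 1)⁻¹ - 1 = -(1 / (r + 1)) by field_simp; ring, neg_le_neg_iff,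
        div_le_div_iff₀ (by positivity) (by positivity)]
      linarith
    linarith
  have hlam : lam' ≤ lamS / (4 * r) := by
    rw [le_div_iff₀ (by positivity)]
    linarith
  calc lamS * (Real.exp (-(1 / r)) - 1) + lam' * (Real.exp 1 - 1)
      ≤ lamS * (-(2 / (3 * r))) + lamS / (4 * r) * 2 := by
        gcongr
        · linarith [Real.add_one_le_exp (1 : ℝ)]
        · linarith [Real.exp_one_lt_three]
    _ = -(lamS / (6 * r)) := by field_simp; norm_num
    _ ≤ -(lamS / (8 * r)) := by gcongr; norm_num

/-- **Tail comparison of independent Poisson variables** ((2.64)).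
There is a universal constant `c > 0` such that, whenever `r ≥ 2`, `λ* ≥ 4 r λ' > 0`,
and `N*`, `N'` are independent Poisson random variables with means `λ*` and `λ'`,
`P(N* < r N') ≤ c exp(-λ*/(c r))`. -/
theorem poisson_comparison :
    ∃ c : ℝ, 0 < c ∧
      ∀ r : ℕ, 2 ≤ r → ∀ lamS lam' : ℝ, 0 < lamS → 0 < lam' →
        4 * r * lam' ≤ lamS →
        ∀ (Ω : Type) (_ : MeasurableSpace Ω) (P : Measure Ω), IsProbabilityMeasure P →
          ∀ (Ns N' : Ω → ℕ), Measurable Ns → Measurable N' →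
            IndepFun Ns N' P →
            (∀ j : ℕ, (P {ω | Ns ω = j}).toReal =
              Real.exp (-lamS) * lamS ^ j / j.factorial) →
            (∀ k : ℕ, (P {ω | N' ω = k}).toReal =
              Real.exp (-lam') * lam' ^ k / k.factorial) →
            (P {ω | Ns ω < r * N' ω}).toReal ≤ c * Real.exp (-(lamS / (c * r))) := by
  refine ⟨8, by norm_num, ?_⟩
  intro r hr lamS lam' hS h' hle Ω _ P _ Ns N' hNs hN' hind hPs hP'
  lift lamS to NNReal using hS.le
  lift lam' to NNReal using h'.le
  have hr' : (2 : ℝ) ≤ r := by exact_mod_cast hr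
  have hr0 : (0 : ℝ) < r := by linarith
  have hind' : IndepFun (fun ω => -(1 / r : ℝ) * Ns ω) (fun ω => (N' ω : ℝ)) P :=
    hind.comp (φ := fun k : ℕ => -(1 / r : ℝ) * k) (ψ := fun k : ℕ => (k : ℝ))
      .of_discrete .of_discrete
  have hintS : Integrable (fun ω => Real.exp (1 * (-(1 / r : ℝ) * Ns ω))) P := by
    simpa only [one_mul] using integrable_exp_mul_of_poisson hNs hPs _
  have hint' := integrable_exp_mul_of_poisson hN' hP' 1
  have hmgf := hind'.mgf_add hintS.aestronglyMeasurable hint'.aestronglyMeasurable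
  rw [mgf_const_mul, mul_one, mgf_of_poisson hNs hPs, mgf_of_poisson hN' hP',
    ← Real.exp_add] at hmgf
  have hsub : {ω | Ns ω < r * N' ω} ⊆
      {ω | 0 ≤ ((fun ω => -(1 / r : ℝ) * Ns ω) + fun ω => (N' ω : ℝ)) ω} := by
    intro ω hω
    have hlt : (Ns ω : ℝ) < r * N' ω := by exact_mod_cast hω
    have hdiv : (Ns ω : ℝ) / r ≤ N' ω := by
      rw [div_le_iff₀ hr0]
      linarith
    change 0 ≤ -(1 / r : ℝ) * Ns ω + N' ω
    rw [neg_mul, one_div_mul_eq_div]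
    linarith
  calc (P {ω | Ns ω < r * N' ω}).toReal
      ≤ P.real {ω | 0 ≤ ((fun ω => -(1 / r : ℝ) * Ns ω) + fun ω => (N' ω : ℝ)) ω} :=
        measureReal_mono hsub
    _ ≤ Real.exp (-(1 : ℝ) * 0) * mgf ((fun ω => -(1 / r : ℝ) * Ns ω) +
          fun ω => (N' ω : ℝ)) P 1 :=
        measure_ge_le_exp_mul_mgf 0 zero_le_one (hind'.integrable_exp_mul_add hintS hint')
    _ = Real.exp (lamS * (Real.exp (-(1 / r)) - 1) + lam' * (Real.exp 1 - 1)) := by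
        rw [hmgf, mul_zero, Real.exp_zero, one_mul]
    _ ≤ Real.exp (-(lamS / (8 * r))) :=
        Real.exp_le_exp.2 (chernoff_exponent_le hr' hS hle)
    _ ≤ 8 * Real.exp (-(lamS / (8 * r))) := by
        linarith [Real.exp_pos (-(lamS / (8 * r)))]
end
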